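/- arXiv:2508.11448 — 2 statements merged into one kernel-verified Lean document; each statement's English description precedes it below -/
import Mathlib

section
/- Let M ≤ ℤ^n and β ∈ ℤ^n with ℤ^n = M ⊕ ℤβ, and let X be an irreducible τ(B)_M-module that is a single point evaluation module, i.e. there is an algebra homomorphism ψ : B → ℂ with (Y⊗b)·u = ψ(b)(Y⊗1)·u for all Y ∈ τ_M, b ∈ B, u ∈ X. Then the irreducible highest weight module 𝕃_{τ(B)}(X, β, M) is a single point evaluation module for τ(B) with the same ψ: (Y⊗b)·v = ψ(b)(Y⊗1)·v for all Y ∈ τ, b ∈ B and all v ∈ 𝕃_{τ(B)}(X, β, M). -/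
open scoped TensorProduct

namespace MT

/-- Presentation of the full toroidal Lie algebra `τ` of rank `n` associated with the
finite-dimensional simple complex Lie algebra `𝔤`, the invariant form `κ` and the
2-cocycle `φ = c₁ • φ₁ + c₂ • φ₂`.  Here `E m x` stands for `x ⊗ t^m`, `K m i` for
`t^m K_i` (the image in the space of Kähler differentials `𝒦 = Ω/dA_n`), and
`W m i` for `t^m d_i`. -/
structure IsFullToroidal (n : ℕ) (𝔤 : Type) [LieRing 𝔤] [LieAlgebra ℂ 𝔤]
    (τ : Type) [LieRing τ] [LieAlgebra ℂ τ]
    (κ : 𝔤 →ₗ[ℂ] 𝔤 →ₗ[ℂ] ℂ) (c₁ c₂ : ℂ)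
    (E : (Fin n → ℤ) → 𝔤 →ₗ[ℂ] τ) (K W : (Fin n → ℤ) → Fin n → τ) : Prop where
  κ_symm : ∀ x y, κ x y = κ y x
  κ_invariant : ∀ x y z, κ ⁅x, y⁆ z = κ x ⁅y, z⁆
  κ_nondeg : ∀ x, (∀ y, κ x y = 0) → x = 0
  span_eq_top : Submodule.span ℂ
      ({z : τ | ∃ m x, z = E m x} ∪ {z : τ | ∃ m i, z = K m i} ∪
        {z : τ | ∃ m i, z = W m i}) = ⊤
  K_rel : ∀ m : Fin n → ℤ, (∑ i, (m i : ℂ) • K m i) = 0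
  lie_E_E : ∀ m k x y, ⁅E m x, E k y⁆
      = E (m + k) ⁅x, y⁆ + κ x y • ∑ i, (m i : ℂ) • K (m + k) i
  lie_E_K : ∀ m x k j, ⁅E m x, K k j⁆ = 0
  lie_K_K : ∀ m i k j, ⁅K m i, K k j⁆ = 0
  lie_W_E : ∀ m i k x, ⁅W m i, E k x⁆ = (k i : ℂ) • E (m + k) x
  lie_W_K : ∀ m i k j, ⁅W m i, K k j⁆
      = (k i : ℂ) • K (m + k) j + (if i = j then ∑ p, (m p : ℂ) • K (m + k) p else 0)
  lie_W_W : ∀ m i k j, ⁅W m i, W k j⁆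
      = (k i : ℂ) • W (m + k) j - (m j : ℂ) • W (m + k) i
        + (c₁ * (-((k i : ℂ) * (m j : ℂ))) + c₂ * ((m i : ℂ) * (k j : ℂ)))
          • ∑ p, (m p : ℂ) • K (m + k) p

/-- The map algebra `τ(B) = τ ⊗ B` is a complex Lie algebra. -/
noncomputable instance mapLieAlgebra (B τ : Type) [CommRing B] [Algebra ℂ B]
    [LieRing τ] [LieAlgebra ℂ τ] : LieAlgebra ℂ (B ⊗[ℂ] τ) :=
  { (inferInstance : Module ℂ (B ⊗[ℂ] τ)) with
    lie_smul := fun c x y => by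
      rw [← algebraMap_smul B c y, lie_smul, algebraMap_smul] }

/-- The simultaneous eigenspace ("weight space") of the commuting family of
operators `d` for the eigenvalue function `l`. -/
def weightSpace {n : ℕ} {L V : Type*} [LieRing L] [LieAlgebra ℂ L] [AddCommGroup V]
    [Module ℂ V] [LieRingModule L V] [LieModule ℂ L V]
    (d : Fin n → L) (l : Fin n → ℂ) : Submodule ℂ V where
  carrier := {v | ∀ i, ⁅d i, v⁆ = l i • v}
  add_mem' := by
    intro a b ha hb i
    rw [lie_add, ha i, hb i, smul_add]
  zero_mem' := by
    intro i
    rw [lie_zero, smul_zero]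
  smul_mem' := by
    intro c a ha i
    rw [lie_smul, ha i, smul_comm]

/-- `V` is a Harish-Chandra module with respect to the degree operators `d`:
the sum of the weight spaces is all of `V` and each weight space is finite
dimensional. -/
def IsHarishChandra {n : ℕ} {L V : Type*} [LieRing L] [LieAlgebra ℂ L] [AddCommGroup V]
    [Module ℂ V] [LieRingModule L V] [LieModule ℂ L V] (d : Fin n → L) : Prop :=
  (⨆ l : Fin n → ℂ, weightSpace (V := V) d l) = ⊤ ∧
    ∀ l : Fin n → ℂ, FiniteDimensional ℂ (weightSpace (V := V) d l)

/-- `V` is cuspidal (uniformly bounded): a Harish-Chandra module whose weight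
space dimensions admit a uniform bound. -/
def IsCuspidal {n : ℕ} {L V : Type*} [LieRing L] [LieAlgebra ℂ L] [AddCommGroup V]
    [Module ℂ V] [LieRingModule L V] [LieModule ℂ L V] (d : Fin n → L) : Prop :=
  IsHarishChandra (V := V) d ∧
    ∃ N : ℕ, ∀ l : Fin n → ℂ, Module.finrank ℂ (weightSpace (V := V) d l) ≤ N

/-- The degree operators `d_i ⊗ 1` inside `τ(B)`. -/
noncomputable def dOp {n : ℕ} (B : Type) [CommRing B] [Algebra ℂ B] {τ : Type}
    [LieRing τ] [LieAlgebra ℂ τ] (W : (Fin n → ℤ) → Fin n → τ) (i : Fin n) :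
    B ⊗[ℂ] τ :=
  (1 : B) ⊗ₜ[ℂ] W 0 i

variable {n : ℕ} {𝔤 : Type} [LieRing 𝔤] [LieAlgebra ℂ 𝔤]
variable {τ : Type} [LieRing τ] [LieAlgebra ℂ τ]

/-- The set of homogeneous generators of `τ` of degree `m`. -/
def genOfDeg (E : (Fin n → ℤ) → 𝔤 →ₗ[ℂ] τ) (K W : (Fin n → ℤ) → Fin n → τ)
    (m : Fin n → ℤ) : Set τ :=
  Set.range (E m) ∪ Set.range (K m) ∪ Set.range (W m)

/-- The homogeneous generators of `τ` of degree lying in the subgroup `M`,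
i.e. generators of `τ_M`. -/
def tauMGens (E : (Fin n → ℤ) → 𝔤 →ₗ[ℂ] τ) (K W : (Fin n → ℤ) → Fin n → τ)
    (M : AddSubgroup (Fin n → ℤ)) : Set τ :=
  {Y | ∃ m ∈ M, Y ∈ genOfDeg E K W m}

/-- The graded piece `τ_m`. -/
def gradedPiece (E : (Fin n → ℤ) → 𝔤 →ₗ[ℂ] τ) (K W : (Fin n → ℤ) → Fin n → τ)
    (m : Fin n → ℤ) : Submodule ℂ τ :=
  Submodule.span ℂ (genOfDeg E K W m)

/-- The subalgebra `τ(B)_M = ⊕_{m ∈ M} τ_m ⊗ B` of `τ(B)`. -/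
noncomputable def tauBM (B : Type) [CommRing B] [Algebra ℂ B]
    (E : (Fin n → ℤ) → 𝔤 →ₗ[ℂ] τ) (K W : (Fin n → ℤ) → Fin n → τ)
    (M : AddSubgroup (Fin n → ℤ)) : LieSubalgebra ℂ (B ⊗[ℂ] τ) :=
  LieSubalgebra.lieSpan ℂ (B ⊗[ℂ] τ)
    {z | ∃ (a : B) (Y : τ), Y ∈ tauMGens E K W M ∧ z = a ⊗ₜ[ℂ] Y}

/-- The degree operators `d_i ⊗ 1` as elements of `τ(B)_M` (note `0 ∈ M`). -/
noncomputable def dOpM (B : Type) [CommRing B] [Algebra ℂ B]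
    (E : (Fin n → ℤ) → 𝔤 →ₗ[ℂ] τ) (K W : (Fin n → ℤ) → Fin n → τ)
    (M : AddSubgroup (Fin n → ℤ)) (i : Fin n) : ↥(tauBM B E K W M) :=
  ⟨(1 : B) ⊗ₜ[ℂ] W 0 i,
    LieSubalgebra.subset_lieSpan
      ⟨1, W 0 i, ⟨0, M.zero_mem, Or.inr ⟨i, rfl⟩⟩, rfl⟩⟩

/-- `(τ ⊗ I)·V = 0`. -/
def annTensor (τ : Type) [LieRing τ] [LieAlgebra ℂ τ] (B : Type) [CommRing B]
    [Algebra ℂ B] (I : Ideal B) (V : Type) [AddCommGroup V] [Module ℂ V]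
    [LieRingModule (B ⊗[ℂ] τ) V] : Prop :=
  ∀ X : τ, ∀ a ∈ I, ∀ v : V, ⁅a ⊗ₜ[ℂ] X, v⁆ = 0

/-- The action of `τ(B)` on `V` is by evaluation at the algebra homomorphism
`ψ : B → ℂ`:  `(X ⊗ b)·v = ψ(b) (X ⊗ 1)·v`. -/
def evalActs (τ : Type) [LieRing τ] [LieAlgebra ℂ τ] (B : Type) [CommRing B]
    [Algebra ℂ B] (ψ : B →ₐ[ℂ] ℂ) (V : Type) [AddCommGroup V] [Module ℂ V]
    [LieRingModule (B ⊗[ℂ] τ) V] : Prop :=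
  ∀ (X : τ) (b : B) (v : V), ⁅b ⊗ₜ[ℂ] X, v⁆ = ψ b • ⁅(1 : B) ⊗ₜ[ℂ] X, v⁆

/-- `v` is annihilated by `τ(B)^+_M = ⊕_{m ∈ M, r ≥ 1} τ(B)_{m + rβ}`. -/
def annPlus (B : Type) [CommRing B] [Algebra ℂ B]
    (E : (Fin n → ℤ) → 𝔤 →ₗ[ℂ] τ) (K W : (Fin n → ℤ) → Fin n → τ)
    (M : AddSubgroup (Fin n → ℤ)) (β : Fin n → ℤ) {V : Type} [AddCommGroup V]
    [Module ℂ V] [LieRingModule (B ⊗[ℂ] τ) V] (v : V) : Prop :=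
  ∀ m₀ ∈ M, ∀ r : ℕ, 0 < r → ∀ a : B,
    (∀ x : 𝔤, ⁅a ⊗ₜ[ℂ] E (m₀ + (r : ℤ) • β) x, v⁆ = 0) ∧
    (∀ i : Fin n, ⁅a ⊗ₜ[ℂ] K (m₀ + (r : ℤ) • β) i, v⁆ = 0) ∧
    (∀ i : Fin n, ⁅a ⊗ₜ[ℂ] W (m₀ + (r : ℤ) • β) i, v⁆ = 0)

/-- Successive action of a list of Lie algebra elements on a module vector:
`actList [x₁, …, x_r] v = x₁ · (x₂ ⋯ (x_r · v))`. -/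
def actList {L V : Type*} [LieRing L] [AddCommGroup V] [LieRingModule L V] :
    List L → V → V
  | [], v => v
  | x :: xs, v => ⁅x, actList xs v⁆

/-- `V` is a highest weight module for `τ(B)`:  there are `M ≤ ℤⁿ` and `β ∈ ℤⁿ`
with `ℤⁿ = M ⊕ ℤβ` and a nonzero `v ∈ V` with `τ(B)^+_M · v = 0` which
generates `V` over `U(τ(B))`. -/
def IsHighestWeightModule (B : Type) [CommRing B] [Algebra ℂ B]
    (E : (Fin n → ℤ) → 𝔤 →ₗ[ℂ] τ) (K W : (Fin n → ℤ) → Fin n → τ)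
    (V : Type) [AddCommGroup V] [Module ℂ V] [LieRingModule (B ⊗[ℂ] τ) V]
    [LieModule ℂ (B ⊗[ℂ] τ) V] : Prop :=
  ∃ (M : AddSubgroup (Fin n → ℤ)) (β : Fin n → ℤ),
    IsCompl M (AddSubgroup.zmultiples β) ∧
    ∃ v : V, v ≠ 0 ∧ annPlus B E K W M β v ∧
      LieSubmodule.lieSpan ℂ (B ⊗[ℂ] τ) {v} = ⊤

/-- Linear independence properties of the generators of the full toroidal Lie
algebra: the only linear relations among the homogeneous generators are the
Kähler relations `∑ᵢ mᵢ t^m K_i = 0`. -/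
structure FreeGens (E : (Fin n → ℤ) → 𝔤 →ₗ[ℂ] τ) (K W : (Fin n → ℤ) → Fin n → τ) :
    Prop where
  K_indep : ∀ (m : Fin n → ℤ) (c : Fin n → ℂ), (∑ i, c i • K m i) = 0 →
      ∃ t : ℂ, ∀ i, c i = t * (m i : ℂ)
  W_indep : ∀ (m : Fin n → ℤ) (c : Fin n → ℂ), (∑ i, c i • W m i) = 0 → ∀ i, c i = 0
  E_inj : ∀ (m : Fin n → ℤ) (x : 𝔤), E m x = 0 → x = 0
  EKW_indep : ∀ (m : Fin n → ℤ) (x : 𝔤) (c d : Fin n → ℂ),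
      E m x + (∑ i, c i • K m i) + (∑ i, d i • W m i) = 0 →
      x = 0 ∧ (∀ i, d i = 0) ∧ ∃ t : ℂ, ∀ i, c i = t * (m i : ℂ)
  graded_indep : ∀ m : Fin n → ℤ,
      gradedPiece E K W m ⊓ (⨆ k : Fin n → ℤ, ⨆ _ : k ≠ m, gradedPiece E K W k) = ⊥

theorem exists_not_isUnit_sub_algebraMap {W : Type*} [AddCommGroup W] [Module ℂ W] [Nontrivial W]
    (hW : Module.rank ℂ W ≤ Cardinal.aleph0) (f : Module.End ℂ W) :
    ∃ a : ℂ, ¬ IsUnit (f - algebraMap ℂ (Module.End ℂ W) a) := by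
  by_contra! h
  have hunit : ∀ q : Polynomial ℂ, q ≠ 0 → IsUnit (Polynomial.aeval f q) := by
    intro q hq
    rw [(IsAlgClosed.splits q).eq_prod_roots, map_mul, Polynomial.aeval_C]
    refine IsUnit.mul ((IsUnit.mk0 _ (Polynomial.leadingCoeff_ne_zero.2 hq)).map
      (algebraMap ℂ (Module.End ℂ W))) ?_
    refine Multiset.prod_induction (fun p => IsUnit (Polynomial.aeval f p)) _
      (fun p r hp hr => by simpa using hp.mul hr) (by simp) ?_
    intro p hp
    obtain ⟨a, -, rfl⟩ := Multiset.mem_map.1 hp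
    simpa using h a
  obtain ⟨x, hx⟩ := exists_ne (0 : W)
  choose g hg using fun a => ((Module.End.isUnit_iff _).1 (h a)).2 x
  have hli : LinearIndependent ℂ g := by
    rw [linearIndependent_iff']
    intro s c hc a ha
    set q : Polynomial ℂ := ∑ a ∈ s, Polynomial.C (c a) * ∏ b ∈ s.erase a,
      (Polynomial.X - Polynomial.C b) with hq
    have hqx : Polynomial.aeval f q x = 0 := by
      have := congrArg (Polynomial.aeval f (∏ b ∈ s, (Polynomial.X - Polynomial.C b))) hc
      rw [map_zero, map_sum] at this
      rw [← this, hq, map_sum, LinearMap.sum_apply]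
      refine Finset.sum_congr rfl fun b hb => ?_
      rw [← Finset.prod_erase_mul _ _ hb, map_mul, map_mul, Module.End.mul_apply,
        Module.End.mul_apply, map_smul, map_smul, Polynomial.aeval_C, map_sub,
        Polynomial.aeval_X, Polynomial.aeval_C, hg, Module.algebraMap_end_apply]
    have hq0 : q = 0 := by
      by_contra hne
      exact hx (((Module.End.isUnit_iff _).1 (hunit q hne)).1 (hqx.trans (map_zero _).symm))
    have hev := congrArg (Polynomial.eval a) hq0
    rw [hq, Polynomial.eval_finsetSum, Finset.sum_eq_single_of_mem a ha] at hev
    · simpa [Polynomial.eval_prod, Finset.prod_eq_zero_iff, sub_eq_zero] using hev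
    · intro b hb hba
      simp [Polynomial.eval_prod, Finset.prod_eq_zero (Finset.mem_erase.2 ⟨hba.symm, ha⟩)]
  have hle := hli.cardinal_lift_le_rank
  have h1 : Cardinal.mk ℂ ≤ Cardinal.aleph0 := by
    exact Cardinal.lift_le_aleph0.1 (hle.trans (Cardinal.lift_le_aleph0.2 hW))
  exact absurd h1 (not_le.2 (by rw [Cardinal.mk_complex]; exact Cardinal.aleph0_lt_continuum))

theorem rank_le_aleph0_of_span_eq_top {W : Type*} [AddCommGroup W] [Module ℂ W] {s : Set W}
    (hs : s.Countable) (hspan : Submodule.span ℂ s = ⊤) : Module.rank ℂ W ≤ Cardinal.aleph0 := by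
  rw [← rank_top, ← hspan]
  exact (rank_span_le s).trans hs.le_aleph0

/-- Dixmier's version of Schur's lemma, for a countable-dimensional space of operators. -/
theorem exists_eq_smul_of_irreducible {V : Type*} [AddCommGroup V] [Module ℂ V]
    (S : Set (Module.End ℂ V)) (hS : Module.rank ℂ (Submodule.span ℂ S) ≤ Cardinal.aleph0)
    (X : Submodule ℂ V) (hXne : X ≠ ⊥) (hstab : ∀ f ∈ S, ∀ u ∈ X, f u ∈ X)
    (hirr : ∀ Y ≤ X, (∀ f ∈ S, ∀ u ∈ Y, f u ∈ Y) → Y = ⊥ ∨ Y = X)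
    (D : Module.End ℂ V) (hD : ∀ u ∈ X, D u ∈ X) (hcomm : ∀ f ∈ S, ∀ u ∈ X, D (f u) = f (D u)) :
    ∃ a : ℂ, ∀ u ∈ X, D u = a • u := by
  obtain ⟨x, hxX, hx⟩ := X.exists_mem_ne_zero_of_ne_bot hXne
  obtain ⟨t, htS, htspan, htli⟩ := exists_linearIndependent ℂ S
  have htc : t.Countable := by
    rw [← Cardinal.le_aleph0_iff_set_countable, ← rank_span_set htli, htspan]
    exact hS
  have := htc.to_subtype
  have hrank : Module.rank ℂ X ≤ Cardinal.aleph0 := by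
    let w : List t → V := fun l => (l.map Subtype.val).prod x
    have hwX : ∀ l, w l ∈ X := by
      intro l
      induction l with
      | nil => simpa [w] using hxX
      | cons f l ih => simpa [w] using hstab f (htS f.2) _ ih
    have hle : Submodule.span ℂ (Set.range w) ≤ X :=
      Submodule.span_le.2 (Set.range_subset_iff.2 hwX)
    have hstab_t : ∀ f ∈ t, ∀ u ∈ Submodule.span ℂ (Set.range w),
        f u ∈ Submodule.span ℂ (Set.range w) := by
      intro f hf u hu
      induction hu using Submodule.span_induction with
      | mem u hu =>
        obtain ⟨l, rfl⟩ := hu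
        exact Submodule.subset_span ⟨⟨f, hf⟩ :: l, by simp [w]⟩
      | zero => simp
      | add u v _ _ hu hv => rw [map_add]; exact add_mem hu hv
      | smul c u _ hu => rw [map_smul]; exact Submodule.smul_mem _ _ hu
    have hstab_S : ∀ f ∈ S, ∀ u ∈ Submodule.span ℂ (Set.range w),
        f u ∈ Submodule.span ℂ (Set.range w) := by
      intro f hf u hu
      have hf' : f ∈ Submodule.span ℂ t := htspan ▸ Submodule.subset_span hf
      clear hf
      induction hf' using Submodule.span_induction with
      | mem f hf => exact hstab_t f hf u hu
      | zero => simp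
      | add f g _ _ hf hg => exact add_mem hf hg
      | smul c f _ hf => exact Submodule.smul_mem _ _ hf
    rcases hirr _ hle hstab_S with h | h
    · refine absurd ?_ hx
      rw [← Submodule.mem_bot ℂ, ← h]
      exact Submodule.subset_span ⟨[], by simp [w]⟩
    · rw [← h]
      exact (rank_span_le _).trans (Set.countable_range w).le_aleph0
  have : Nontrivial X := (Submodule.nontrivial_iff_ne_bot).2 hXne
  obtain ⟨a, ha⟩ := exists_not_isUnit_sub_algebraMap hrank (D.restrict hD)
  refine ⟨a, ?_⟩
  rw [Module.End.isUnit_iff] at ha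
  have hker := hirr (X ⊓ LinearMap.ker (D - algebraMap ℂ _ a)) inf_le_left (by
    rintro f hf u ⟨hu, hku⟩
    refine ⟨hstab f hf u hu, ?_⟩
    rw [SetLike.mem_coe, LinearMap.mem_ker, LinearMap.sub_apply, Module.algebraMap_end_apply,
      sub_eq_zero] at hku ⊢
    rw [hcomm f hf u hu, hku, map_smul])
  have hmap := hirr (X.map (D - algebraMap ℂ _ a)) (by
    rintro _ ⟨u, hu, rfl⟩
    exact sub_mem (hD u hu) (X.smul_mem a hu)) (by
    rintro f hf _ ⟨u, hu, rfl⟩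
    refine ⟨f u, hstab f hf u hu, ?_⟩
    simp [hcomm f hf u hu])
  rcases hker with hker | hker
  · refine absurd ⟨?_, ?_⟩ ha
    · rw [← LinearMap.ker_eq_bot, LinearMap.ker_eq_bot']
      intro u hu
      have : (u : V) ∈ X ⊓ LinearMap.ker (D - algebraMap ℂ _ a) := by
        refine ⟨u.2, ?_⟩
        simpa using congrArg Subtype.val hu
      rw [hker] at this
      simpa using this
    · rcases hmap with hmap | hmap
      · refine absurd ?_ hx
        rw [← Submodule.mem_bot ℂ, ← hker]
        refine ⟨hxX, ?_⟩
        rw [SetLike.mem_coe, LinearMap.mem_ker, ← Submodule.mem_bot ℂ, ← hmap]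
        exact Submodule.mem_map_of_mem hxX
      · rintro ⟨y, hy⟩
        rw [← hmap] at hy
        obtain ⟨u, hu, rfl⟩ := hy
        exact ⟨⟨u, hu⟩, Subtype.ext (by simp)⟩
  · intro u hu
    rw [← hker] at hu
    have := hu.2
    rwa [SetLike.mem_coe, LinearMap.mem_ker, LinearMap.sub_apply, Module.algebraMap_end_apply,
      sub_eq_zero] at this

theorem rank_le_aleph0_of_finiteType (B : Type*) [CommRing B] [Algebra ℂ B]
    (hB : Algebra.FiniteType ℂ B) : Module.rank ℂ B ≤ Cardinal.aleph0 := by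
  obtain ⟨k, f, hf⟩ := Algebra.FiniteType.iff_quotient_mvPolynomial''.1 hB
  refine rank_le_aleph0_of_span_eq_top (Set.countable_range fun s : Fin k →₀ ℕ =>
    f (MvPolynomial.monomial s 1)) ?_
  have := (MvPolynomial.basisMonomials (Fin k) ℂ).span_eq
  have h2 := congrArg (Submodule.map f.toLinearMap) this
  rw [Submodule.map_span, ← Set.range_comp, Submodule.map_top, LinearMap.range_eq_top.2 hf] at h2
  simpa [Function.comp_def] using h2
variable {B : Type} [CommRing B] [Algebra ℂ B] {V : Type} [AddCommGroup V] [Module ℂ V]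
  [LieRingModule (B ⊗[ℂ] τ) V] [LieModule ℂ (B ⊗[ℂ] τ) V]

/-- The linear map sending `z` to the operator `v ↦ z · v`. -/
noncomputable def actMap (B τ V : Type) [CommRing B] [Algebra ℂ B] [LieRing τ] [LieAlgebra ℂ τ]
    [AddCommGroup V] [Module ℂ V] [LieRingModule (B ⊗[ℂ] τ) V] [LieModule ℂ (B ⊗[ℂ] τ) V] :
    B ⊗[ℂ] τ →ₗ[ℂ] Module.End ℂ V :=
  (LieModule.toEnd ℂ (B ⊗[ℂ] τ) V : B ⊗[ℂ] τ →ₗ[ℂ] Module.End ℂ V)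

@[simp] theorem actMap_apply (z : B ⊗[ℂ] τ) (v : V) : actMap B τ V z v = ⁅z, v⁆ := rfl

theorem lie_mem_of_span_eq_top {G : Set τ} (hG : Submodule.span ℂ G = ⊤) (N : Submodule ℂ V)
    (hN : ∀ Y ∈ G, ∀ b : B, ∀ u ∈ N, ⁅b ⊗ₜ[ℂ] Y, u⁆ ∈ N) (z : B ⊗[ℂ] τ) {u : V} (hu : u ∈ N) :
    ⁅z, u⁆ ∈ N := by
  induction z using TensorProduct.induction_on with
  | zero => simp
  | tmul b Y =>
    have hY : Y ∈ Submodule.span ℂ G := hG ▸ Submodule.mem_top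
    induction hY using Submodule.span_induction with
    | mem Y hY => exact hN Y hY b u hu
    | zero => simp
    | add Y Z _ _ hY hZ => rw [TensorProduct.tmul_add, add_lie]; exact add_mem hY hZ
    | smul c Y _ hY => rw [TensorProduct.tmul_smul, smul_lie]; exact N.smul_mem c hY
  | add y z hy hz => rw [add_lie]; exact add_mem hy hz

/-- In an irreducible module, a nonzero subspace stable under a spanning set is everything. -/
theorem eq_top_of_stable (hirr : LieModule.IsIrreducible ℂ (B ⊗[ℂ] τ) V) {G : Set τ}
    (hG : Submodule.span ℂ G = ⊤) (N : Submodule ℂ V) (hne : N ≠ ⊥)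
    (hN : ∀ Y ∈ G, ∀ b : B, ∀ u ∈ N, ⁅b ⊗ₜ[ℂ] Y, u⁆ ∈ N) : N = ⊤ := by
  let N' : LieSubmodule ℂ (B ⊗[ℂ] τ) V :=
    { N with lie_mem := fun {z u} hu => lie_mem_of_span_eq_top hG N hN z hu }
  have h : N' = ⊤ := by
    refine (hirr.eq_bot_or_eq_top N').resolve_left fun h => hne ?_
    exact congrArg LieSubmodule.toSubmodule h
  exact congrArg LieSubmodule.toSubmodule h

/-- The vectors annihilated by `τ ⊗ ker ψ`. -/
def kerInvariants (τ : Type) [LieRing τ] [LieAlgebra ℂ τ] {B : Type} [CommRing B] [Algebra ℂ B]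
    (ψ : B →ₐ[ℂ] ℂ) (V : Type) [AddCommGroup V] [Module ℂ V]
    [LieRingModule (B ⊗[ℂ] τ) V] [LieModule ℂ (B ⊗[ℂ] τ) V] : Submodule ℂ V where
  carrier := {v | ∀ (Y : τ) (b : B), ψ b = 0 → ⁅b ⊗ₜ[ℂ] Y, v⁆ = 0}
  add_mem' ha hb Y b h := by rw [lie_add, ha Y b h, hb Y b h, add_zero]
  zero_mem' Y b _ := lie_zero _
  smul_mem' c v hv Y b h := by rw [lie_smul, hv Y b h, smul_zero]

/-- An irreducible module with a nonzero vector annihilated by `τ ⊗ ker ψ` is an evaluation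
module. -/
theorem evalActs_of_kerInvariants_ne_bot (hirr : LieModule.IsIrreducible ℂ (B ⊗[ℂ] τ) V)
    (ψ : B →ₐ[ℂ] ℂ) (hne : kerInvariants τ ψ V ≠ ⊥) : evalActs τ B ψ V := by
  have htop := eq_top_of_stable hirr Submodule.span_univ (kerInvariants τ ψ V) hne (by
    intro Y _ b u hu Z c hc
    rw [leibniz_lie, LieAlgebra.ExtendScalars.bracket_tmul, hu Z c hc, lie_zero, add_zero]
    exact hu _ _ (by rw [map_mul, hc, zero_mul]))
  intro Y b v
  have hv : v ∈ kerInvariants τ ψ V := htop ▸ Submodule.mem_top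
  have h := hv Y (b - algebraMap ℂ B (ψ b)) (by simp)
  rwa [TensorProduct.sub_tmul, sub_lie, sub_eq_zero, Algebra.algebraMap_eq_smul_one,
    ← TensorProduct.smul_tmul', smul_lie] at h

theorem lie_mem_of_mem_span {G : Set τ} (N : Submodule ℂ V) {b : B} {u : V}
    (hG : ∀ Y ∈ G, ⁅b ⊗ₜ[ℂ] Y, u⁆ ∈ N) {Y : τ} (hY : Y ∈ Submodule.span ℂ G) :
    ⁅b ⊗ₜ[ℂ] Y, u⁆ ∈ N := by
  induction hY using Submodule.span_induction with
  | mem Y hY => exact hG Y hY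
  | zero => simp
  | add Y Z _ _ hY hZ => rw [TensorProduct.tmul_add, add_lie]; exact add_mem hY hZ
  | smul c Y _ hY => rw [TensorProduct.tmul_smul, smul_lie]; exact N.smul_mem c hY

/-- A subspace `N` which is annihilated by the positive part, stable under the degree zero part,
and on which the degree operator acts by a scalar `l`, generates an irreducible module `V` through
the negative part alone; hence `V` is a sum of eigenspaces for `l - j`, `j ≥ 0`. -/
theorem iSup_eigenspace_eq_top (hirr : LieModule.IsIrreducible ℂ (B ⊗[ℂ] τ) V)
    (T : ℤ → Set τ) (hT : Submodule.span ℂ (⋃ r, T r) = ⊤)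
    (hbr : ∀ r s, ∀ Y ∈ T r, ∀ Z ∈ T s, ⁅Y, Z⁆ ∈ Submodule.span ℂ (T (r + s)))
    (D : τ) (hD : ∀ r, ∀ Y ∈ T r, ⁅D, Y⁆ = (r : ℂ) • Y)
    (N : Submodule ℂ V) (hne : N ≠ ⊥) (hstab : ∀ r ≥ 0, ∀ Y ∈ T r, ∀ b : B, ∀ u ∈ N,
      ⁅b ⊗ₜ[ℂ] Y, u⁆ ∈ N) (l : ℂ) (hl : ∀ u ∈ N, ⁅(1 : B) ⊗ₜ[ℂ] D, u⁆ = l • u) :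
    ⨆ j : ℕ, (actMap B τ V (1 ⊗ₜ[ℂ] D)).eigenspace (l - j) = ⊤ := by
  set f := actMap B τ V (1 ⊗ₜ[ℂ] D) with hf
  let P : Set (Submodule ℂ V) :=
    {C | N ≤ C ∧ ∀ r < 0, ∀ Y ∈ T r, ∀ b : B, ∀ u ∈ C, ⁅b ⊗ₜ[ℂ] Y, u⁆ ∈ C}
  have hNC : N ≤ sInf P := le_sInf fun C hC => hC.1
  have hneg : ∀ r < 0, ∀ Y ∈ T r, ∀ b : B, ∀ u ∈ sInf P, ⁅b ⊗ₜ[ℂ] Y, u⁆ ∈ sInf P := by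
    intro r hr Y hY b u hu
    rw [Submodule.mem_sInf] at hu ⊢
    exact fun C hC => hC.2 r hr Y hY b u (hu C hC)
  have hpos : ∀ u ∈ sInf P, ∀ r ≥ 0, ∀ Y ∈ T r, ∀ b : B, ⁅b ⊗ₜ[ℂ] Y, u⁆ ∈ sInf P := by
    let C : Submodule ℂ V :=
      { carrier := {u | u ∈ sInf P ∧ ∀ r ≥ 0, ∀ Y ∈ T r, ∀ b : B, ⁅b ⊗ₜ[ℂ] Y, u⁆ ∈ sInf P}
        add_mem' := fun {u v} hu hv => ⟨add_mem hu.1 hv.1, fun r hr Y hY b => by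
          rw [lie_add]; exact add_mem (hu.2 r hr Y hY b) (hv.2 r hr Y hY b)⟩
        zero_mem' := ⟨zero_mem _, fun r hr Y hY b => by rw [lie_zero]; exact zero_mem _⟩
        smul_mem' := fun c u hu => ⟨Submodule.smul_mem _ c hu.1, fun r hr Y hY b => by
          rw [lie_smul]; exact Submodule.smul_mem _ c (hu.2 r hr Y hY b)⟩ }
    have hC : C ∈ P := by
      refine ⟨fun u hu => ⟨hNC hu, fun r hr Y hY b => hNC (hstab r hr Y hY b u hu)⟩, ?_⟩
      rintro s hs Z hZ c u ⟨hu, hu'⟩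
      refine ⟨hneg s hs Z hZ c u hu, fun r hr Y hY b => ?_⟩
      rw [leibniz_lie, LieAlgebra.ExtendScalars.bracket_tmul]
      refine add_mem (lie_mem_of_mem_span _ (fun y hy => ?_) (hbr r s Y hY Z hZ))
        (hneg s hs Z hZ c _ (hu' r hr Y hY b))
      rcases lt_or_ge (r + s) 0 with h | h
      · exact hneg _ h y hy _ u hu
      · exact hu' _ h y hy _
    exact fun u hu => (sInf_le hC hu).2
  have htop : sInf P = ⊤ := by
    refine eq_top_of_stable hirr hT _ (ne_bot_of_le_ne_bot hne hNC) fun Y hY b u hu => ?_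
    obtain ⟨r, hr⟩ := Set.mem_iUnion.1 hY
    rcases lt_or_ge r 0 with h | h
    · exact hneg r h Y hr b u hu
    · exact hpos u hu r h Y hr b
  rw [eq_top_iff, ← htop]
  refine sInf_le ⟨fun u hu => ?_, fun r hr Y hY b u hu => ?_⟩
  · refine Submodule.mem_iSup_of_mem 0 ?_
    rw [Module.End.mem_eigenspace_iff]
    simpa [hf] using hl u hu
  · obtain ⟨k, rfl⟩ : ∃ k : ℕ, r = -k := ⟨r.natAbs, by omega⟩
    induction hu using Submodule.iSup_induction' with
    | mem j u hu =>
      refine Submodule.mem_iSup_of_mem (j + k) ?_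
      rw [Module.End.mem_eigenspace_iff, hf, actMap_apply] at hu ⊢
      rw [leibniz_lie, LieAlgebra.ExtendScalars.bracket_tmul, hu, hD _ Y hY, one_mul,
        TensorProduct.tmul_smul, smul_lie, lie_smul, ← add_smul]
      congr 1
      push_cast
      ring
    | zero => simp
    | add u v _ _ hu hv => rw [lie_add]; exact add_mem hu hv

/-- The evaluation property propagates from the highest weight space to the whole irreducible
module, for a Lie algebra with an inner `ℤ`-grading. -/
theorem evalActs_of_graded (hτ : Module.rank ℂ τ ≤ Cardinal.aleph0)
    (hB : Module.rank ℂ B ≤ Cardinal.aleph0)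
    (hirr : LieModule.IsIrreducible ℂ (B ⊗[ℂ] τ) V)
    (T : ℤ → Set τ) (hT : Submodule.span ℂ (⋃ r, T r) = ⊤)
    (hbr : ∀ r s, ∀ Y ∈ T r, ∀ Z ∈ T s, ⁅Y, Z⁆ ∈ Submodule.span ℂ (T (r + s)))
    (D : τ) (hD0 : D ∈ Submodule.span ℂ (T 0)) (hD : ∀ r, ∀ Y ∈ T r, ⁅D, Y⁆ = (r : ℂ) • Y)
    (ψ : B →ₐ[ℂ] ℂ) (X : Submodule ℂ V) (hXne : X ≠ ⊥)
    (hplus : ∀ r > 0, ∀ Y ∈ T r, ∀ b : B, ∀ u ∈ X, ⁅b ⊗ₜ[ℂ] Y, u⁆ = 0)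
    (hstab : ∀ Y ∈ T 0, ∀ b : B, ∀ u ∈ X, ⁅b ⊗ₜ[ℂ] Y, u⁆ ∈ X)
    (hXirr : ∀ N ≤ X, (∀ Y ∈ T 0, ∀ b : B, ∀ u ∈ N, ⁅b ⊗ₜ[ℂ] Y, u⁆ ∈ N) → N = ⊥ ∨ N = X)
    (hψ : ∀ Y ∈ T 0, ∀ b : B, ∀ u ∈ X, ⁅b ⊗ₜ[ℂ] Y, u⁆ = ψ b • ⁅(1 : B) ⊗ₜ[ℂ] Y, u⁆) :
    evalActs τ B ψ V := by
  obtain ⟨l, hl⟩ : ∃ l : ℂ, ∀ u ∈ X, actMap B τ V (1 ⊗ₜ[ℂ] D) u = l • u := by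
    refine exists_eq_smul_of_irreducible {g | ∃ Y ∈ T 0, ∃ b : B, g = actMap B τ V (b ⊗ₜ[ℂ] Y)}
      ?_ X hXne ?_ ?_ _ ?_ ?_
    · have h1 : Submodule.span ℂ {g | ∃ Y ∈ T 0, ∃ b : B, g = actMap B τ V (b ⊗ₜ[ℂ] Y)} ≤
          LinearMap.range (actMap B τ V) := by
        rw [Submodule.span_le]
        rintro _ ⟨Y, _, b, rfl⟩
        exact ⟨_, rfl⟩
      refine (Submodule.rank_mono h1).trans ((rank_range_le _).trans ?_)
      rw [rank_tensorProduct']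
      exact (mul_le_mul' hB hτ).trans Cardinal.aleph0_mul_aleph0.le
    · rintro _ ⟨Y, hY, b, rfl⟩ u hu
      exact hstab Y hY b u hu
    · exact fun N hN h => hXirr N hN fun Y hY b u hu => h _ ⟨Y, hY, b, rfl⟩ u hu
    · exact fun u hu => lie_mem_of_mem_span X (fun Y hY => hstab Y hY 1 u hu) hD0
    · rintro _ ⟨Y, hY, b, rfl⟩ u hu
      simp only [actMap_apply]
      rw [leibniz_lie, LieAlgebra.ExtendScalars.bracket_tmul, hD 0 Y hY]
      simp
  have key : ∀ k : ℕ, ∀ r : ℤ, -k ≤ r → ∀ Y ∈ T r, ∀ b, ψ b = 0 → ∀ u ∈ X,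
      ⁅b ⊗ₜ[ℂ] Y, u⁆ = 0 := by
    intro k
    induction k with
    | zero =>
      intro r hr Y hY b hb u hu
      rcases (show 0 ≤ r by simpa using hr).eq_or_lt with rfl | h
      · rw [hψ Y hY b u hu, hb, zero_smul]
      · exact hplus r h Y hY b u hu
    | succ k ih =>
      intro r hr Y hY b hb u hu
      rcases le_or_gt (-(k : ℤ)) r with h | h
      · exact ih r h Y hY b hb u hu
      obtain rfl : r = -(k + 1 : ℤ) := by push_cast at hr; omega
      by_contra hne
      let N : Submodule ℂ V := Submodule.span ℂ
        {w | ∃ Y ∈ T (-(k + 1 : ℤ)), ∃ b : B, ψ b = 0 ∧ ∃ u ∈ X, w = ⁅b ⊗ₜ[ℂ] Y, u⁆}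
      have hNne : N ≠ ⊥ := by
        intro hN
        refine hne ?_
        rw [← Submodule.mem_bot ℂ, ← hN]
        exact Submodule.subset_span ⟨Y, hY, b, hb, u, hu, rfl⟩
      have htop := iSup_eigenspace_eq_top hirr T hT hbr D hD N hNne (by
        intro s hs Z hZ c w hw
        induction hw using Submodule.span_induction with
        | mem w hw =>
          obtain ⟨Y, hY, b, hb, u, hu, rfl⟩ := hw
          have hcb : ψ (c * b) = 0 := by rw [map_mul, hb, mul_zero]
          rw [leibniz_lie, LieAlgebra.ExtendScalars.bracket_tmul]
          refine add_mem (lie_mem_of_mem_span N (fun y hy => ?_) (hbr _ _ Z hZ Y hY)) ?_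
          · rcases hs.eq_or_lt with rfl | hs
            · rw [zero_add] at hy
              exact Submodule.subset_span ⟨y, hy, c * b, hcb, u, hu, rfl⟩
            · rw [ih _ (by omega) y hy _ hcb u hu]
              exact zero_mem N
          · rcases hs.eq_or_lt with rfl | hs
            · exact Submodule.subset_span ⟨Y, hY, b, hb, _, hstab Z hZ c u hu, rfl⟩
            · rw [hplus s hs Z hZ c u hu, lie_zero]
              exact zero_mem N
        | zero => rw [lie_zero]; exact zero_mem N
        | add u v _ _ hu hv => rw [lie_add]; exact add_mem hu hv
        | smul a u _ hu => rw [lie_smul]; exact N.smul_mem a hu) (l - (k + 1)) (by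
        intro w hw
        induction hw using Submodule.span_induction with
        | mem w hw =>
          obtain ⟨Y, hY, b, hb, u, hu, rfl⟩ := hw
          have hlu := hl u hu
          rw [actMap_apply] at hlu
          rw [leibniz_lie, LieAlgebra.ExtendScalars.bracket_tmul, hlu, hD _ Y hY, one_mul,
            TensorProduct.tmul_smul, smul_lie, lie_smul, ← add_smul]
          congr 1
          push_cast
          ring
        | zero => simp
        | add u v _ _ hu hv => rw [lie_add, hu, hv, smul_add]
        | smul a u _ hu => rw [lie_smul, hu, smul_comm])
      have hdisj := (actMap B τ V (1 ⊗ₜ[ℂ] D)).eigenspaces_iSupIndep l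
      have hle : (⊤ : Submodule ℂ V) ≤ ⨆ (m : ℂ) (_ : m ≠ l),
          (actMap B τ V (1 ⊗ₜ[ℂ] D)).eigenspace m := by
        rw [← htop]
        refine iSup_le fun j => le_iSup₂_of_le (l - (k + 1) - j) ?_ le_rfl
        intro h
        have h2 : ((k + 1 + j : ℕ) : ℂ) = 0 := by
          push_cast
          linear_combination -h
        rw [Nat.cast_eq_zero] at h2
        omega
      rw [top_le_iff.1 hle, disjoint_top] at hdisj
      refine hXne (eq_bot_iff.2 fun u hu => ?_)
      rw [← hdisj, Module.End.mem_eigenspace_iff]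
      exact hl u hu
  refine evalActs_of_kerInvariants_ne_bot hirr ψ (ne_bot_of_le_ne_bot hXne fun u hu Y b hb => ?_)
  have hY : Y ∈ Submodule.span ℂ (⋃ r, T r) := hT ▸ Submodule.mem_top
  rw [← Submodule.mem_bot ℂ]
  refine lie_mem_of_mem_span ⊥ (fun Z hZ => ?_) hY
  obtain ⟨r, hr⟩ := Set.mem_iUnion.1 hZ
  exact (Submodule.mem_bot ℂ).2 (key r.natAbs r (by omega) Z hr b hb u hu)

/-- The projection `ℤⁿ = M ⊕ ℤβ → ℤ`, written as a functional `k ↦ ∑ aᵢ kᵢ` (zero if `β = 0`). -/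
theorem exists_degree_of_isCompl {n : ℕ} (M : AddSubgroup (Fin n → ℤ)) (β : Fin n → ℤ)
    (hcompl : IsCompl M (AddSubgroup.zmultiples β)) :
    ∃ a : Fin n → ℤ, (∀ k, 0 < a ⬝ᵥ k → ∃ m ∈ M, ∃ r : ℕ, 0 < r ∧ k = m + (r : ℤ) • β) ∧
      ∀ k, a ⬝ᵥ k = 0 ↔ k ∈ M := by
  by_cases hβ : β = 0
  · subst hβ
    have hM : M = ⊤ := by simpa using hcompl.sup_eq_top
    exact ⟨0, by simp, by simp [hM]⟩
  have hex : ∀ k, ∃ r : ℤ, k - r • β ∈ M := by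
    intro k
    have hk : k ∈ M ⊔ AddSubgroup.zmultiples β := by rw [hcompl.sup_eq_top]; trivial
    obtain ⟨m, hm, _, ⟨r, rfl⟩, rfl⟩ := AddSubgroup.mem_sup.1 hk
    exact ⟨r, by simpa using hm⟩
  have huniq : ∀ (k : Fin n → ℤ) (r s : ℤ), k - r • β ∈ M → k - s • β ∈ M → r = s := by
    intro k r s hr hs
    have h : (r - s) • β ∈ M ⊓ AddSubgroup.zmultiples β := by
      refine ⟨?_, ⟨r - s, rfl⟩⟩
      have := M.sub_mem hs hr
      rwa [sub_sub_sub_cancel_left, ← sub_smul] at this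
    rw [hcompl.inf_eq_bot, AddSubgroup.mem_bot, smul_eq_zero, sub_eq_zero] at h
    exact h.resolve_right hβ
  choose f hf using hex
  let F : (Fin n → ℤ) →+ ℤ := AddMonoidHom.mk' f fun k l => huniq (k + l) _ _ (hf _) (by
    rw [add_smul, add_sub_add_comm]
    exact M.add_mem (hf k) (hf l))
  have hF : ∀ k, (fun i => F (Pi.single i 1)) ⬝ᵥ k = f k := by
    intro k
    change _ = F k
    conv_rhs => rw [← Finset.univ_sum_single k, map_sum]
    refine Finset.sum_congr rfl fun i _ => ?_
    rw [show (Pi.single i (k i) : Fin n → ℤ) = k i • Pi.single i 1 by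
      rw [← Pi.single_smul, smul_eq_mul, mul_one], map_zsmul, smul_eq_mul, mul_comm]
  refine ⟨fun i => F (Pi.single i 1), fun k hk => ?_, fun k => ?_⟩
  · rw [hF] at hk
    exact ⟨_, hf k, (f k).toNat, by omega, by rw [Int.toNat_of_nonneg hk.le, sub_add_cancel]⟩
  · rw [hF]
    refine ⟨fun h => by simpa [h] using hf k, fun h => huniq k _ _ (hf k) (by simpa using h)⟩

variable {E : (Fin n → ℤ) → 𝔤 →ₗ[ℂ] τ} {K W : (Fin n → ℤ) → Fin n → τ}

/-- The homogeneous generators of `τ` whose degree `k` satisfies `∑ aᵢ kᵢ = r`. -/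
def degGens (E : (Fin n → ℤ) → 𝔤 →ₗ[ℂ] τ) (K W : (Fin n → ℤ) → Fin n → τ) (a : Fin n → ℤ)
    (r : ℤ) : Set τ :=
  {Y | ∃ k, a ⬝ᵥ k = r ∧ Y ∈ genOfDeg E K W k}

theorem mem_genOfDeg {k : Fin n → ℤ} {Y : τ} : Y ∈ genOfDeg E K W k ↔
    (∃ x, Y = E k x) ∨ (∃ i, Y = K k i) ∨ ∃ i, Y = W k i := by
  simp [genOfDeg, or_assoc, eq_comm]

theorem E_mem_gradedPiece (k : Fin n → ℤ) (x : 𝔤) : E k x ∈ gradedPiece E K W k :=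
  Submodule.subset_span (mem_genOfDeg.2 (Or.inl ⟨x, rfl⟩))

theorem K_mem_gradedPiece (k : Fin n → ℤ) (i : Fin n) : K k i ∈ gradedPiece E K W k :=
  Submodule.subset_span (mem_genOfDeg.2 (Or.inr (Or.inl ⟨i, rfl⟩)))

theorem W_mem_gradedPiece (k : Fin n → ℤ) (i : Fin n) : W k i ∈ gradedPiece E K W k :=
  Submodule.subset_span (mem_genOfDeg.2 (Or.inr (Or.inr ⟨i, rfl⟩)))

theorem sum_K_mem_gradedPiece (c : Fin n → ℂ) (k : Fin n → ℤ) :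
    ∑ i, c i • K k i ∈ gradedPiece E K W k :=
  sum_mem fun i _ => Submodule.smul_mem _ _ (K_mem_gradedPiece k i)

namespace IsFullToroidal

variable {κ : 𝔤 →ₗ[ℂ] 𝔤 →ₗ[ℂ] ℂ} {c₁ c₂ : ℂ}

theorem span_degGens (hτ : IsFullToroidal n 𝔤 τ κ c₁ c₂ E K W)
    (a : Fin n → ℤ) : Submodule.span ℂ (⋃ r, degGens E K W a r) = ⊤ := by
  rw [eq_top_iff, ← hτ.span_eq_top]
  refine Submodule.span_mono ?_
  rintro Y ((⟨k, x, rfl⟩ | ⟨k, i, rfl⟩) | ⟨k, i, rfl⟩) <;>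
    refine Set.mem_iUnion.2 ⟨_, k, rfl, mem_genOfDeg.2 ?_⟩
  · exact Or.inl ⟨x, rfl⟩
  · exact Or.inr (Or.inl ⟨i, rfl⟩)
  · exact Or.inr (Or.inr ⟨i, rfl⟩)

theorem rank_le_aleph0 [FiniteDimensional ℂ 𝔤] (hτ : IsFullToroidal n 𝔤 τ κ c₁ c₂ E K W) :
    Module.rank ℂ τ ≤ Cardinal.aleph0 := by
  let b := Module.finBasis ℂ 𝔤
  refine rank_le_aleph0_of_span_eq_top (((Set.countable_range
    fun p : (Fin n → ℤ) × Fin (Module.finrank ℂ 𝔤) => E p.1 (b p.2)).union (Set.countable_range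
    fun p : (Fin n → ℤ) × Fin n => K p.1 p.2)).union (Set.countable_range
    fun p : (Fin n → ℤ) × Fin n => W p.1 p.2)) ?_
  rw [eq_top_iff, ← hτ.span_eq_top, Submodule.span_le]
  rintro Y ((⟨k, x, rfl⟩ | ⟨k, i, rfl⟩) | ⟨k, i, rfl⟩)
  · rw [SetLike.mem_coe, ← b.sum_repr x, map_sum]
    refine sum_mem fun i _ => ?_
    rw [map_smul]
    exact Submodule.smul_mem _ _ (Submodule.subset_span (Or.inl (Or.inl ⟨(k, i), rfl⟩)))
  · exact Submodule.subset_span (Or.inl (Or.inr ⟨(k, i), rfl⟩))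
  · exact Submodule.subset_span (Or.inr ⟨(k, i), rfl⟩)

theorem lie_mem_gradedPiece (hτ : IsFullToroidal n 𝔤 τ κ c₁ c₂ E K W)
    {k l : Fin n → ℤ} {Y Z : τ} (hY : Y ∈ genOfDeg E K W k)
    (hZ : Z ∈ genOfDeg E K W l) : ⁅Y, Z⁆ ∈ gradedPiece E K W (k + l) := by
  have hWE : ∀ k i l x, ⁅W k i, E l x⁆ ∈ gradedPiece E K W (k + l) := fun k i l x => by
    rw [hτ.lie_W_E]
    exact Submodule.smul_mem _ _ (E_mem_gradedPiece _ _)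
  have hWK : ∀ k i l j, ⁅W k i, K l j⁆ ∈ gradedPiece E K W (k + l) := fun k i l j => by
    rw [hτ.lie_W_K]
    refine add_mem (Submodule.smul_mem _ _ (K_mem_gradedPiece _ _)) ?_
    split_ifs
    · exact sum_K_mem_gradedPiece _ _
    · exact zero_mem _
  rw [mem_genOfDeg] at hY hZ
  rcases hY with ⟨x, rfl⟩ | ⟨i, rfl⟩ | ⟨i, rfl⟩ <;> rcases hZ with ⟨y, rfl⟩ | ⟨j, rfl⟩ | ⟨j, rfl⟩
  · rw [hτ.lie_E_E]
    exact add_mem (E_mem_gradedPiece _ _) (Submodule.smul_mem _ _ (sum_K_mem_gradedPiece _ _))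
  · rw [hτ.lie_E_K]
    exact zero_mem _
  · rw [← lie_skew, add_comm]
    exact neg_mem (hWE _ _ _ _)
  · rw [← lie_skew, hτ.lie_E_K, neg_zero]
    exact zero_mem _
  · rw [hτ.lie_K_K]
    exact zero_mem _
  · rw [← lie_skew, add_comm]
    exact neg_mem (hWK _ _ _ _)
  · exact hWE _ _ _ _
  · exact hWK _ _ _ _
  · rw [hτ.lie_W_W]
    exact add_mem (sub_mem (Submodule.smul_mem _ _ (W_mem_gradedPiece _ _))
      (Submodule.smul_mem _ _ (W_mem_gradedPiece _ _)))
      (Submodule.smul_mem _ _ (sum_K_mem_gradedPiece _ _))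

theorem lie_degGens (hτ : IsFullToroidal n 𝔤 τ κ c₁ c₂ E K W)
    (a : Fin n → ℤ) (r s : ℤ) : ∀ Y ∈ degGens E K W a r,
    ∀ Z ∈ degGens E K W a s, ⁅Y, Z⁆ ∈ Submodule.span ℂ (degGens E K W a (r + s)) := by
  rintro Y ⟨k, rfl, hY⟩ Z ⟨l, rfl, hZ⟩
  have hsub : genOfDeg E K W (k + l) ⊆ degGens E K W a (a ⬝ᵥ k + a ⬝ᵥ l) :=
    fun y hy => ⟨k + l, dotProduct_add _ _ _, hy⟩
  exact Submodule.span_mono hsub (hτ.lie_mem_gradedPiece hY hZ)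

theorem lie_degree (hτ : IsFullToroidal n 𝔤 τ κ c₁ c₂ E K W)
    (a : Fin n → ℤ) (r : ℤ) : ∀ Y ∈ degGens E K W a r,
    ⁅∑ i, (a i : ℂ) • W 0 i, Y⁆ = (r : ℂ) • Y := by
  rintro Y ⟨k, rfl, hY⟩
  have hW : ∀ i, ⁅W 0 i, Y⁆ = (k i : ℂ) • Y := by
    intro i
    rcases mem_genOfDeg.1 hY with ⟨x, rfl⟩ | ⟨j, rfl⟩ | ⟨j, rfl⟩
    · rw [hτ.lie_W_E, zero_add]
    · simp [hτ.lie_W_K]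
    · simp [hτ.lie_W_W]
  simp_rw [sum_lie, smul_lie, hW, smul_smul]
  rw [← Finset.sum_smul]
  simp [dotProduct]

end IsFullToroidal

theorem statement_3
    (n : ℕ) (hn : 3 ≤ n)
    (𝔤 : Type) [LieRing 𝔤] [LieAlgebra ℂ 𝔤] [LieAlgebra.IsSimple ℂ 𝔤]
    [FiniteDimensional ℂ 𝔤]
    (τ : Type) [LieRing τ] [LieAlgebra ℂ τ]
    (κ : 𝔤 →ₗ[ℂ] 𝔤 →ₗ[ℂ] ℂ) (c₁ c₂ : ℂ)
    (E : (Fin n → ℤ) → 𝔤 →ₗ[ℂ] τ) (K W : (Fin n → ℤ) → Fin n → τ)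
    (hτ : IsFullToroidal n 𝔤 τ κ c₁ c₂ E K W)
    (B : Type) [CommRing B] [Algebra ℂ B] [Nontrivial B]
    (hB : Algebra.FiniteType ℂ B)
    (V : Type) [AddCommGroup V] [Module ℂ V]
    [LieRingModule (B ⊗[ℂ] τ) V] [LieModule ℂ (B ⊗[ℂ] τ) V]
    (hirr : LieModule.IsIrreducible ℂ (B ⊗[ℂ] τ) V)
    (M : AddSubgroup (Fin n → ℤ)) (β : Fin n → ℤ)
    (hcompl : IsCompl M (AddSubgroup.zmultiples β))
    (ψ : B →ₐ[ℂ] ℂ) (X : Submodule ℂ V) (hXne : X ≠ ⊥)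
    -- `X` is annihilated by `τ(B)^+_M`
    (hplus : ∀ v ∈ X, annPlus B E K W M β v)
    -- `X` is stable under `τ(B)_M`
    (hstab : ∀ Y ∈ tauMGens E K W M, ∀ a : B, ∀ u ∈ X, ⁅a ⊗ₜ[ℂ] Y, u⁆ ∈ X)
    -- `X` is an irreducible `τ(B)_M`-module
    (hXirr : ∀ Y' : Submodule ℂ V, Y' ≤ X →
      (∀ Z ∈ tauMGens E K W M, ∀ a : B, ∀ u ∈ Y', ⁅a ⊗ₜ[ℂ] Z, u⁆ ∈ Y') →
      Y' = ⊥ ∨ Y' = X)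
    -- `X` generates `V` (so `V` is the irreducible highest weight module `𝕃(X, β, M)`)
    (hgen : LieSubmodule.lieSpan ℂ (B ⊗[ℂ] τ) (X : Set V) = ⊤)
    -- `τ(B)_M` acts on `X` through the evaluation `ψ`
    (hψ : ∀ Y ∈ tauMGens E K W M, ∀ b : B, ∀ u ∈ X,
      ⁅b ⊗ₜ[ℂ] Y, u⁆ = ψ b • ⁅(1 : B) ⊗ₜ[ℂ] Y, u⁆) :
    evalActs τ B ψ V := by
  obtain ⟨a, hpos, hker⟩ := exists_degree_of_isCompl M β hcompl
  have hgens : degGens E K W a 0 = tauMGens E K W M := by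
    ext Y
    simp only [degGens, tauMGens, Set.mem_ofPred_eq, hker]
  refine evalActs_of_graded hτ.rank_le_aleph0 (rank_le_aleph0_of_finiteType B hB) hirr
    (degGens E K W a) (hτ.span_degGens a) (hτ.lie_degGens a) (∑ i, (a i : ℂ) • W 0 i)
    (sum_mem fun i _ => Submodule.smul_mem _ _ (Submodule.subset_span
      ⟨0, dotProduct_zero a, mem_genOfDeg.2 (Or.inr (Or.inr ⟨i, rfl⟩))⟩))
    (hτ.lie_degree a) ψ X hXne ?_ (hgens ▸ hstab) (hgens ▸ hXirr) (hgens ▸ hψ)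
  rintro _ hr Y ⟨k, rfl, hY⟩ b u hu
  obtain ⟨m, hm, r, hr₀, rfl⟩ := hpos k hr
  obtain ⟨hE, hK, hW⟩ := hplus u hu m hm r hr₀ b
  rcases mem_genOfDeg.1 hY with ⟨x, rfl⟩ | ⟨i, rfl⟩ | ⟨i, rfl⟩
  · exact hE x
  · exact hK i
  · exact hW i

end MT
end

section
/- Let M be a subgroup of ℤ^n with ℤ^n = M ⊕ ℤβ for some β ∈ ℤ^n, and let X be an irreducible cuspidal module over τ(B)_M (i.e. X is a weight module with respect to D = span{d_1,…,d_n} whose weight spaces have uniformly bounded finite dimensions). Then X is a single point evaluation module for τ(B)_M: there exists a maximal ideal 𝔐 of B with (τ_M ⊗ 𝔐)·X = 0. -/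
open scoped TensorProduct

namespace MT

variable {n : ℕ} {𝔤 : Type} [LieRing 𝔤] [LieAlgebra ℂ 𝔤]
variable {τ : Type} [LieRing τ] [LieAlgebra ℂ τ]

/-- An integer vector viewed as a complex vector. -/
def toC (m : Fin n → ℤ) : Fin n → ℂ := fun i => (m i : ℂ)

lemma toC_add (m k : Fin n → ℤ) : toC (m + k) = toC m + toC k := by
  ext i; simp [toC]

lemma toC_neg (m : Fin n → ℤ) : toC (-m) = -toC m := by
  ext i; simp [toC]

lemma toC_zero : toC (0 : Fin n → ℤ) = 0 := by
  ext i; simp [toC]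

/-- `∑ᵢ vᵢ Fᵢ(m)` as a linear function of `v`, for `F = K` or `F = W`. -/
noncomputable def lin (F : (Fin n → ℤ) → Fin n → τ) (m : Fin n → ℤ) : (Fin n → ℂ) →ₗ[ℂ] τ :=
  Fintype.linearCombination ℂ (F m)

lemma lin_apply (F : (Fin n → ℤ) → Fin n → τ) (m : Fin n → ℤ) (v : Fin n → ℂ) :
    lin F m v = ∑ i, v i • F m i := by
  simp [lin, Fintype.linearCombination_apply]

lemma lin_single (F : (Fin n → ℤ) → Fin n → τ) (m : Fin n → ℤ) (i : Fin n) :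
    lin F m (Pi.single i 1) = F m i := by
  simp [lin]

/-- `x ⊗ t^m + ∑ sᵢ t^m Kᵢ + ∑ vᵢ t^m dᵢ` as a linear function of `(x, s, v)`. -/
noncomputable def homogMap (E : (Fin n → ℤ) → 𝔤 →ₗ[ℂ] τ) (K W : (Fin n → ℤ) → Fin n → τ)
    (m : Fin n → ℤ) : (𝔤 × (Fin n → ℂ) × (Fin n → ℂ)) →ₗ[ℂ] τ :=
  (E m).coprod ((lin K m).coprod (lin W m))

/-- The homogeneous component `τ_m`, as the range of `homogMap`. -/
noncomputable def homog (E : (Fin n → ℤ) → 𝔤 →ₗ[ℂ] τ) (K W : (Fin n → ℤ) → Fin n → τ)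
    (m : Fin n → ℤ) : Submodule ℂ τ :=
  LinearMap.range (homogMap E K W m)

/-- Two integer vectors are independent: some `2 × 2` minor does not vanish. -/
def Indep (k l : Fin n → ℤ) : Prop := ∃ i j, k i * l j ≠ k j * l i

lemma Indep.symm {k l : Fin n → ℤ} (h : Indep k l) : Indep l k := by
  obtain ⟨i, j, h⟩ := h
  exact ⟨j, i, fun h' => h (by linarith)⟩

lemma Indep.exists_dual {k l : Fin n → ℤ} (h : Indep k l) :
    ∃ p : Fin n → ℂ, p ⬝ᵥ toC k = 1 ∧ p ⬝ᵥ toC l = 0 := by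
  obtain ⟨i, j, h⟩ := h
  have hΔ : (k i * l j - k j * l i : ℂ) ≠ 0 := by
    rw [sub_ne_zero]; exact_mod_cast h
  refine ⟨(k i * l j - k j * l i : ℂ)⁻¹ •
    (Pi.single i (l j : ℂ) - Pi.single j (l i : ℂ)), ?_, ?_⟩
  · simp only [smul_dotProduct, sub_dotProduct, single_dotProduct, toC, smul_eq_mul]
    field_simp
  · simp only [smul_dotProduct, sub_dotProduct, single_dotProduct, toC, smul_eq_mul]
    ring

lemma Indep.ne_zero_left {k l : Fin n → ℤ} (h : Indep k l) : k ≠ 0 := by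
  rintro rfl
  obtain ⟨i, j, h⟩ := h
  simp at h

lemma Indep.ne_zero_right {k l : Fin n → ℤ} (h : Indep k l) : l ≠ 0 := h.symm.ne_zero_left

/-- A vector `t ≠ 0` cannot be parallel to `m`, `m + k₁` and `m + k₂` if `k₁`, `k₂` are
independent. -/
lemma Indep.exists_indep_add {k₁ k₂ : Fin n → ℤ} (h : Indep k₁ k₂) {t : Fin n → ℤ} (ht : t ≠ 0)
    (m : Fin n → ℤ) : ∃ j, (j = 0 ∨ j = k₁ ∨ j = k₂) ∧ Indep (m + j) t := by
  by_contra! hc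
  have h0 := hc 0 (by simp)
  have h1 := hc k₁ (by simp)
  have h2 := hc k₂ (by simp)
  simp only [Indep, not_exists, not_not, Pi.add_apply, Pi.zero_apply, add_zero] at h0 h1 h2
  obtain ⟨a, ha⟩ := Function.ne_iff.mp ht
  obtain ⟨i, j, hij⟩ := h
  have e1 : ∀ b, k₁ b * t a = k₁ a * t b := fun b => by linarith [h0 b a, h1 b a]
  have e2 : ∀ b, k₂ b * t a = k₂ a * t b := fun b => by linarith [h0 b a, h2 b a]
  apply hij
  have hta : t a * t a ≠ 0 := mul_ne_zero ha ha
  apply mul_right_cancel₀ hta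
  linear_combination (k₂ j * t a) * e1 i + (k₁ a * t i) * e2 j -
    (k₂ i * t a) * e1 j - (k₁ a * t j) * e2 i

lemma Indep.sub_right {x t : Fin n → ℤ} (h : Indep x t) : Indep x (t - x) := by
  obtain ⟨i, j, h⟩ := h
  refine ⟨i, j, fun h' => h ?_⟩
  simp only [Pi.sub_apply] at h'
  linarith

/-- A complement of a cyclic subgroup in `ℤⁿ`, `n ≥ 3`, contains two independent vectors. -/
lemma exists_indep (hn : 3 ≤ n) {M : AddSubgroup (Fin n → ℤ)} {β : Fin n → ℤ}
    (h : IsCompl M (AddSubgroup.zmultiples β)) : ∃ k₁ ∈ M, ∃ k₂ ∈ M, Indep k₁ k₂ := by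
  have key : ∀ x : Fin n → ℤ, ∃ c : ℤ, x - c • β ∈ M := fun x => by
    have hx : x ∈ M ⊔ AddSubgroup.zmultiples β := by rw [h.sup_eq_top]; trivial
    obtain ⟨y, hy, z, hz, rfl⟩ := AddSubgroup.mem_sup.mp hx
    obtain ⟨c, rfl⟩ := AddSubgroup.mem_zmultiples_iff.mp hz
    exact ⟨c, by simpa using hy⟩
  let i₀ : Fin n := ⟨0, by omega⟩
  let i₁ : Fin n := ⟨1, by omega⟩
  let i₂ : Fin n := ⟨2, by omega⟩
  have h01 : i₀ ≠ i₁ := by simp [i₀, i₁]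
  have h02 : i₀ ≠ i₂ := by simp [i₀, i₂]
  have h12 : i₁ ≠ i₂ := by simp [i₁, i₂]
  let e : Fin n → (Fin n → ℤ) := fun i => Pi.single i 1
  obtain ⟨c₀, hc₀⟩ := key (e i₀)
  obtain ⟨c₁, hc₁⟩ := key (e i₁)
  obtain ⟨c₂, hc₂⟩ := key (e i₂)
  have comb : ∀ {x y : Fin n → ℤ} {a b : ℤ}, x - a • β ∈ M → y - b • β ∈ M →
      b • x - a • y ∈ M := fun {x y a b} hx hy => by
    have := M.sub_mem (M.zsmul_mem hx b) (M.zsmul_mem hy a)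
    rwa [show b • (x - a • β) - a • (y - b • β) = b • x - a • y by
      simp only [smul_sub, smul_smul, mul_comm]; abel] at this
  have m01 := comb hc₀ hc₁
  have m02 := comb hc₀ hc₂
  have m12 := comb hc₁ hc₂
  by_cases z0 : c₀ = 0
  · by_cases z1 : c₁ = 0
    · refine ⟨_, hc₀, _, hc₁, i₀, i₁, ?_⟩
      simp [z0, z1, e, h01, h01.symm]
    · refine ⟨_, hc₀, _, m12, i₀, i₂, ?_⟩
      simp [z0, z1, e, h01, h02, h02.symm, h12.symm]
  · refine ⟨_, m01, _, m02, i₁, i₂, ?_⟩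
    simp [z0, e, h12, h01.symm, h02.symm, h12.symm]

/-- There is a linear functional that vanishes at no nonzero integer vector. -/
lemma exists_generic (n : ℕ) :
    ∃ u : Fin n → ℂ, ∀ m : Fin n → ℤ, m ≠ 0 → u ⬝ᵥ toC m ≠ 0 := by
  have htr : Transcendental ℤ (liouvilleNumber (2 : ℕ)) := transcendental_liouvilleNumber le_rfl
  refine ⟨fun i => ((liouvilleNumber (2 : ℕ) : ℝ) : ℂ) ^ (i : ℕ), fun m hm h0 => hm ?_⟩
  set x : ℝ := liouvilleNumber (2 : ℕ)
  let P : Polynomial ℤ := ∑ i : Fin n, Polynomial.monomial (i : ℕ) (m i)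
  have hP : Polynomial.aeval x P = 0 := by
    have h1 : ∑ i : Fin n, x ^ (i : ℕ) * (m i : ℝ) = 0 := by
      have : ((∑ i : Fin n, x ^ (i : ℕ) * (m i : ℝ) : ℝ) : ℂ) = 0 := by
        push_cast
        exact h0
      exact_mod_cast this
    rw [← h1]
    simp [P, Polynomial.aeval_monomial, mul_comm]
  have hP0 := transcendental_iff.mp htr P hP
  ext i
  have : P.coeff (i : ℕ) = m i := by
    simp [P, Polynomial.coeff_monomial, Fin.val_inj]
  rw [← this, hP0]; simp

section Homogeneous

variable {E : (Fin n → ℤ) → 𝔤 →ₗ[ℂ] τ} {K W : (Fin n → ℤ) → Fin n → τ}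

lemma E_mem_homog (m : Fin n → ℤ) (x : 𝔤) : E m x ∈ homog E K W m :=
  ⟨(x, 0, 0), by simp [homogMap]⟩

lemma K_mem_homog (m : Fin n → ℤ) (s : Fin n → ℂ) : lin K m s ∈ homog E K W m :=
  ⟨(0, s, 0), by simp [homogMap]⟩

lemma W_mem_homog (m : Fin n → ℤ) (v : Fin n → ℂ) : lin W m v ∈ homog E K W m :=
  ⟨(0, 0, v), by simp [homogMap]⟩

lemma homog_le {m : Fin n → ℤ} {U : Submodule ℂ τ} (hE : ∀ x, E m x ∈ U)
    (hK : ∀ s, lin K m s ∈ U) (hW : ∀ v, lin W m v ∈ U) : homog E K W m ≤ U := by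
  rintro _ ⟨⟨x, s, v⟩, rfl⟩
  simp only [homogMap, LinearMap.coprod_apply]
  exact U.add_mem (hE x) (U.add_mem (hK s) (hW v))

variable {κ : 𝔤 →ₗ[ℂ] 𝔤 →ₗ[ℂ] ℂ} {c₁ c₂ : ℂ}

namespace IsFullToroidal

variable (hτ : IsFullToroidal n 𝔤 τ κ c₁ c₂ E K W)
include hτ

lemma K_toC_self (m : Fin n → ℤ) : lin K m (toC m) = 0 := by
  simpa [lin_apply, toC] using hτ.K_rel m

lemma lin_E_E (m k : Fin n → ℤ) (x y : 𝔤) :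
    ⁅E m x, E k y⁆ = E (m + k) ⁅x, y⁆ + κ x y • lin K (m + k) (toC m) := by
  simpa [lin_apply, toC] using hτ.lie_E_E m k x y

lemma lin_E_K (m k : Fin n → ℤ) (x : 𝔤) (s : Fin n → ℂ) : ⁅E m x, lin K k s⁆ = 0 := by
  simp [lin_apply, lie_sum, lie_smul, hτ.lie_E_K]

lemma lin_K_K (m k : Fin n → ℤ) (r s : Fin n → ℂ) : ⁅lin K m r, lin K k s⁆ = 0 := by
  simp [lin_apply, lie_sum, sum_lie, lie_smul, smul_lie, hτ.lie_K_K]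

lemma lin_W_E (m k : Fin n → ℤ) (u : Fin n → ℂ) (x : 𝔤) :
    ⁅lin W m u, E k x⁆ = (u ⬝ᵥ toC k) • E (m + k) x := by
  simp [lin_apply, sum_lie, smul_lie, hτ.lie_W_E, dotProduct, Finset.sum_smul, mul_smul, toC]

lemma lin_W_K (m k : Fin n → ℤ) (u s : Fin n → ℂ) :
    ⁅lin W m u, lin K k s⁆ =
      (u ⬝ᵥ toC k) • lin K (m + k) s + (u ⬝ᵥ s) • lin K (m + k) (toC m) := by
  rw [lin_apply W, lin_apply K k, sum_lie]
  simp only [lie_sum, smul_lie, lie_smul, hτ.lie_W_K]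
  have hK : ∑ p, (m p : ℂ) • K (m + k) p = lin K (m + k) (toC m) := by
    simp [lin_apply, toC]
  rw [hK, lin_apply K (m + k) s, Finset.smul_sum]
  simp only [smul_add, Finset.sum_add_distrib, smul_ite, smul_zero, Finset.sum_ite_eq,
    Finset.mem_univ, if_true, dotProduct, Finset.sum_smul, mul_smul, toC]
  congr 1
  · rw [Finset.sum_comm]
    refine Finset.sum_congr rfl fun j _ => Finset.sum_congr rfl fun i _ => ?_
    simp only [smul_smul]; ring_nf
  · exact Finset.sum_congr rfl fun i _ => smul_comm _ _ _

lemma lin_W_W (m k : Fin n → ℤ) (u v : Fin n → ℂ) :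
    ⁅lin W m u, lin W k v⁆ =
      (u ⬝ᵥ toC k) • lin W (m + k) v - (v ⬝ᵥ toC m) • lin W (m + k) u +
        (-c₁ * ((u ⬝ᵥ toC k) * (v ⬝ᵥ toC m)) + c₂ * ((u ⬝ᵥ toC m) * (v ⬝ᵥ toC k))) •
          lin K (m + k) (toC m) := by
  rw [lin_apply W m, lin_apply W k, sum_lie]
  simp only [lie_sum, smul_lie, lie_smul, hτ.lie_W_W]
  have hK : ∑ p, (m p : ℂ) • K (m + k) p = lin K (m + k) (toC m) := by
    simp [lin_apply, toC]
  rw [hK, lin_apply W (m + k) v, lin_apply W (m + k) u]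
  simp only [smul_add, smul_sub, Finset.sum_add_distrib, Finset.sum_sub_distrib]
  congr 1
  · congr 1
    · simp only [dotProduct, Finset.sum_smul, Finset.smul_sum, toC]
      rw [Finset.sum_comm]
      refine Finset.sum_congr rfl fun i _ => Finset.sum_congr rfl fun j _ => ?_
      simp only [smul_smul]; ring_nf
    · simp only [dotProduct, Finset.sum_smul, Finset.smul_sum, toC]
      refine Finset.sum_congr rfl fun i _ => Finset.sum_congr rfl fun j _ => ?_
      simp only [smul_smul]; ring_nf
  · simp only [smul_smul, ← Finset.sum_smul]
    congr 1
    simp only [dotProduct, toC, Finset.sum_mul_sum]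
    simp only [Finset.mul_sum, ← Finset.sum_add_distrib]
    refine Finset.sum_congr rfl fun i _ => Finset.sum_congr rfl fun j _ => ?_
    ring

/-- The components `τ_m` form a grading: `⁅τ_m, τ_k⁆ ⊆ τ_{m+k}`. -/
lemma lie_mem_homog {m k : Fin n → ℤ} {Y Z : τ} (hY : Y ∈ homog E K W m)
    (hZ : Z ∈ homog E K W k) : ⁅Y, Z⁆ ∈ homog E K W (m + k) := by
  obtain ⟨⟨x, s, v⟩, rfl⟩ := hY
  obtain ⟨⟨y, r, w⟩, rfl⟩ := hZ
  have hE := fun x => E_mem_homog (E := E) (K := K) (W := W) (m + k) x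
  have hK := fun x => K_mem_homog (E := E) (K := K) (W := W) (m + k) x
  have hW := fun x => W_mem_homog (E := E) (K := K) (W := W) (m + k) x
  have sw := fun s r => hτ.lin_W_K k m s r
  have se := fun s r => hτ.lin_W_E k m s r
  rw [add_comm k m] at sw se
  simp only [homogMap, LinearMap.coprod_apply, add_lie, lie_add]
  rw [hτ.lin_E_E, hτ.lin_E_K, ← lie_skew (E m x) (lin W k w), se, ← lie_skew (lin K m s) (E k y),
    hτ.lin_E_K, hτ.lin_K_K, ← lie_skew (lin K m s) (lin W k w), sw, hτ.lin_W_E, hτ.lin_W_K,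
    hτ.lin_W_W]
  have sm := fun (c : ℂ) {z : τ} (h : z ∈ homog E K W (m + k)) => Submodule.smul_mem _ c h
  simp only [neg_zero, zero_add]
  repeat' first
    | apply Submodule.add_mem | apply Submodule.sub_mem | apply Submodule.neg_mem
    | apply sm | apply hE | apply hK | apply hW

lemma lie_degree_s4 {m : Fin n → ℤ} {Y : τ} (hY : Y ∈ homog E K W m) (v : Fin n → ℂ) :
    ⁅lin W 0 v, Y⁆ = (v ⬝ᵥ toC m) • Y := by
  obtain ⟨⟨x, s, w⟩, rfl⟩ := hY
  simp [homogMap, lie_add, hτ.lin_W_E, hτ.lin_W_K, hτ.lin_W_W, toC_zero]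

/-- For independent degrees `k`, `l` one has `τ_{k+l} = ⁅τ_k, τ_l⁆`. -/
lemma homog_le_of_indep {k l : Fin n → ℤ} (h : Indep k l) {U : Submodule ℂ τ}
    (hU : ∀ Y ∈ homog E K W k, ∀ Z ∈ homog E K W l, ⁅Y, Z⁆ ∈ U) : homog E K W (k + l) ≤ U := by
  obtain ⟨p, pk, pl⟩ := h.exists_dual
  obtain ⟨q, ql, qk⟩ := h.symm.exists_dual
  have hKk : lin K (k + l) (toC k) ∈ U := by
    have := hU _ (W_mem_homog k p) _ (K_mem_homog l (toC k))
    rwa [hτ.lin_W_K, pl, pk, zero_smul, zero_add, one_smul] at this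
  have hK : ∀ s, lin K (k + l) s ∈ U := fun s => by
    have := hU _ (W_mem_homog k q) _ (K_mem_homog l s)
    rw [hτ.lin_W_K, ql, one_smul] at this
    exact (U.add_mem_iff_left (U.smul_mem _ hKk)).mp this
  refine homog_le (fun x => ?_) hK fun w => ?_
  · have := hU _ (W_mem_homog k q) _ (E_mem_homog l x)
    rwa [hτ.lin_W_E, ql, one_smul] at this
  · have h1 := hU _ (W_mem_homog k q) _ (W_mem_homog l (w - (w ⬝ᵥ toC k) • p))
    have h2 := hU _ (W_mem_homog k p) _ (W_mem_homog l p)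
    rw [hτ.lin_W_W] at h1 h2
    replace h1 := (U.add_mem_iff_left (U.smul_mem _ (hK _))).mp h1
    replace h2 := (U.add_mem_iff_left (U.smul_mem _ (hK _))).mp h2
    simp only [ql, pk, pl, sub_dotProduct, smul_dotProduct, smul_eq_mul, mul_one, sub_self,
      zero_smul, one_smul, sub_zero, zero_sub, map_sub, map_smul] at h1 h2
    have := U.sub_mem h1 (U.smul_mem (w ⬝ᵥ toC k) h2)
    simpa using this

/-- The Heisenberg-type relation `⁅t^k d_u, t^{-k} d_w⁆ = (u · k) d_w` in degree zero, where
`w · k = 0`. -/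
lemma lin_W_W_neg {k : Fin n → ℤ} {u w : Fin n → ℂ} (hw : w ⬝ᵥ toC k = 0) :
    ⁅lin W (-k) u, lin W k w⁆ = (u ⬝ᵥ toC k) • lin W 0 w := by
  simp [hτ.lin_W_W, toC_neg, hw]

/-- `τ_0` is spanned by brackets `⁅P, Q⁆` with `P` and `Q` of opposite nonzero degrees and
`⁅P, ⁅P, Q⁆⁆ = 0`. -/
lemma homog_zero_le {k₁ k₂ : Fin n → ℤ} (h : Indep k₁ k₂) {U : Submodule ℂ τ}
    (hU : ∀ k, (k = k₁ ∨ k = k₂) → ∀ P ∈ homog E K W (-k), ∀ Q ∈ homog E K W k,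
      ⁅P, ⁅P, Q⁆⁆ = 0 → ⁅P, Q⁆ ∈ U) : homog E K W 0 ≤ U := by
  obtain ⟨p, p1, p2⟩ := h.exists_dual
  obtain ⟨q, q2, q1⟩ := h.symm.exists_dual
  have hWK : ∀ (k : Fin n → ℤ), (k = k₁ ∨ k = k₂) → ∀ u s,
      (u ⬝ᵥ toC k) • lin K 0 s - (u ⬝ᵥ s) • lin K 0 (toC k) ∈ U := fun k hk u s => by
    have e : ⁅lin W (-k) u, lin K k s⁆ =
        (u ⬝ᵥ toC k) • lin K 0 s - (u ⬝ᵥ s) • lin K 0 (toC k) := by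
      rw [hτ.lin_W_K, neg_add_cancel, toC_neg, map_neg, smul_neg, sub_eq_add_neg]
    rw [← e]
    refine hU k hk _ (W_mem_homog _ u) _ (K_mem_homog _ s) ?_
    rw [e, lie_sub, lie_smul, lie_smul, hτ.lin_W_K, hτ.lin_W_K, toC_zero, add_zero,
      hτ.K_toC_self]
    simp
  have hWW : ∀ (k : Fin n → ℤ), (k = k₁ ∨ k = k₂) → ∀ u w, w ⬝ᵥ toC k = 0 →
      (u ⬝ᵥ toC k) • lin W 0 w ∈ U := fun k hk u w hw => by
    rw [← hτ.lin_W_W_neg hw]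
    refine hU k hk _ (W_mem_homog _ u) _ (W_mem_homog _ w) ?_
    rw [hτ.lin_W_W_neg hw, lie_smul, hτ.lin_W_W, add_zero, hτ.K_toC_self, toC_neg, toC_zero]
    simp [hw]
  have hK1 : lin K 0 (toC k₁) ∈ U := by
    simpa [q1, q2] using hWK k₁ (Or.inl rfl) q (toC k₂)
  refine homog_le (fun x => ?_) (fun s => ?_) fun w => ?_
  · have e : ⁅lin W (-k₁) p, E k₁ x⁆ = E 0 x := by
      rw [hτ.lin_W_E, p1, neg_add_cancel, one_smul]
    rw [← e]
    refine hU k₁ (Or.inl rfl) _ (W_mem_homog _ p) _ (E_mem_homog _ x) ?_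
    rw [e, hτ.lin_W_E, toC_zero]
    simp
  · have := hWK k₁ (Or.inl rfl) p s
    rw [p1, one_smul] at this
    exact (U.sub_mem_iff_left (U.smul_mem _ hK1)).mp this
  · have h1 := hWW k₁ (Or.inl rfl) p (w - (w ⬝ᵥ toC k₁) • p) (by simp [p1])
    have h2 := hWW k₂ (Or.inr rfl) q p p2
    rw [p1, one_smul] at h1
    rw [q2, one_smul] at h2
    have := U.add_mem h1 (U.smul_mem (w ⬝ᵥ toC k₁) h2)
    simpa using this

end IsFullToroidal

end Homogeneous

section Operators

variable {R : Type*} [Ring R] [Algebra ℂ R]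

lemma mul_pow_succ_of_commutator {D x y : R} (h : D * x - x * D = y) (hxy : Commute x y) (s : ℕ) :
    D * x ^ (s + 1) = x ^ (s + 1) * D + (s + 1 : ℂ) • (x ^ s * y) := by
  have hD : D * x = x * D + y := by rw [← h]; abel
  induction s with
  | zero => simp [hD]
  | succ s ih =>
    rw [pow_succ x (s + 1), ← mul_assoc, ih, add_mul, mul_assoc, hD, mul_add, smul_mul_assoc,
      mul_assoc (x ^ s), ← hxy.eq, ← mul_assoc (x ^ s), ← pow_succ, ← mul_assoc, add_assoc]
    congr 1
    push_cast
    module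

/-- If `y = [D, x]` commutes with `D` and `x`, then `x ^ N = 0` implies `y ^ N = 0`. -/
lemma pow_eq_zero_of_commutator {D x y : R} (h : D * x - x * D = y) (hxy : Commute x y)
    (hDy : Commute D y) {N : ℕ} (hx : x ^ N = 0) : y ^ N = 0 := by
  have key : ∀ s r : ℕ, x ^ s * y ^ r = 0 → y ^ (r + s) = 0 := by
    intro s
    induction s with
    | zero => intro r hr; simpa using hr
    | succ s ih =>
      intro r hr
      have h1 : (D * x ^ (s + 1)) * y ^ r = 0 := by rw [mul_assoc, hr, mul_zero]
      rw [mul_pow_succ_of_commutator h hxy, add_mul, mul_assoc, (hDy.pow_right r).eq, ← mul_assoc,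
        hr, zero_mul, zero_add, smul_mul_assoc, mul_assoc, ← pow_succ'] at h1
      have := ih (r + 1) ((smul_eq_zero.mp h1).resolve_left (by exact_mod_cast s.succ_ne_zero))
      rwa [add_right_comm] at this
  simpa using key N 0 (by simpa using hx)

/-- A nilpotent element has no nonzero eigenvectors for its commutator action, except for the
eigenvalue zero. -/
lemma eq_zero_of_isNilpotent_commutator {x y : R} {α : ℂ} (hα : α ≠ 0) (hx : IsNilpotent x)
    (h : x * y - y * x = α • y) : y = 0 := by
  have hxy : SemiconjBy y (x + algebraMap ℂ R α) x := by
    rw [SemiconjBy, mul_add, ← Algebra.commutes, ← Algebra.smul_def, ← h]; abel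
  obtain ⟨N, hN⟩ := hx
  have h0 : y * (x + algebraMap ℂ R α) ^ N = 0 := by
    rw [(hxy.pow_right N).eq, hN, zero_mul]
  have hu : IsUnit (x + algebraMap ℂ R α) :=
    IsNilpotent.isUnit_add_right_of_commute ⟨N, hN⟩ ((isUnit_iff_ne_zero.mpr hα).map _)
      (Algebra.commutes α x).symm
  exact (hu.pow N).mul_left_eq_zero.mp h0

/-- In a finite-dimensional algebra, `[h, p] = α p` with `α ≠ 0` forces `p` to be nilpotent. -/
lemma isNilpotent_of_commutator [FiniteDimensional ℂ R] {h p : R} {α : ℂ} (hα : α ≠ 0)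
    (hp : h * p - p * h = α • p) : IsNilpotent p := by
  by_contra hnil
  have key : ∀ j : ℕ, h * p ^ j - p ^ j * h = ((j : ℂ) * α) • p ^ j := by
    intro j
    induction j with
    | zero => simp
    | succ j ih =>
      have : h * p ^ (j + 1) - p ^ (j + 1) * h =
          (h * p ^ j - p ^ j * h) * p + p ^ j * (h * p - p * h) := by
        rw [pow_succ]; noncomm_ring
      rw [this, ih, hp, smul_mul_assoc, mul_smul_comm, ← pow_succ]
      push_cast
      module
  have hli := Module.End.eigenvectors_linearIndependent' (R := ℂ) (M := R)
    (LinearMap.mulLeft ℂ h - LinearMap.mulRight ℂ h) (fun j : ℕ => (j : ℂ) * α)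
    (fun i j hij => by simpa [hα] using hij) (fun j : ℕ => p ^ j)
    (fun j => ⟨Module.End.mem_eigenspace_iff.mpr (by simpa using key j),
      fun h0 => hnil ⟨j, h0⟩⟩)
  have := hli.finite
  exact not_finite ℕ

/-- A nilpotent endomorphism of a space of dimension at most `N` has vanishing `N`-th power. -/
lemma pow_eq_zero_of_finrank_le {V : Type*} [AddCommGroup V] [Module ℂ V] [FiniteDimensional ℂ V]
    {f : Module.End ℂ V} (hf : IsNilpotent f) {N : ℕ} (hN : Module.finrank ℂ V ≤ N) :
    f ^ N = 0 := by
  obtain ⟨k, hk⟩ := hf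
  refine pow_eq_zero_of_le hN ?_
  rw [← LinearMap.ker_eq_top, ← Module.End.ker_pow_eq_ker_pow_finrank_of_le (le_max_left _ k),
    LinearMap.ker_eq_top]
  exact pow_eq_zero_of_le (le_max_right _ _) hk

/-- A finite family of commuting nilpotent operators has a common kernel vector in every
nonzero invariant set `P`. -/
lemma exists_common_kernel {V ι : Type*} [AddCommGroup V] [Module ℂ V] (S : Finset ι)
    (f : ι → Module.End ℂ V) (hc : ∀ i j, Commute (f i) (f j)) (hf : ∀ i, IsNilpotent (f i))
    (P : V → Prop) (hP : ∀ i x, P x → P (f i x)) {x : V} (hx : x ≠ 0) (hPx : P x) :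
    ∃ y, y ≠ 0 ∧ P y ∧ ∀ i ∈ S, f i y = 0 := by
  classical
  induction S using Finset.induction_on generalizing P with
  | empty => exact ⟨x, hx, hPx, by simp⟩
  | insert i S _ ih =>
    obtain ⟨y, hy, hPy, hSy⟩ := ih P hP hPx
    have hex : ∃ r, (f i ^ r) y = 0 := by
      obtain ⟨r, hr⟩ := hf i
      exact ⟨r, by simp [hr]⟩
    have h0 : Nat.find hex ≠ 0 := fun h0 => hy (by simpa [h0] using Nat.find_spec hex)
    obtain ⟨r, hr⟩ := Nat.exists_eq_succ_of_ne_zero h0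
    refine ⟨(f i ^ r) y, Nat.find_min hex (by omega), ?_, fun j hj => ?_⟩
    · clear hr
      induction r with
      | zero => simpa
      | succ r ihr => rw [pow_succ', Module.End.mul_apply]; exact hP _ _ ihr
    · rcases Finset.mem_insert.mp hj with rfl | hj
      · rw [← Module.End.mul_apply, ← pow_succ', ← Nat.succ_eq_add_one, ← hr]
        exact Nat.find_spec hex
      · rw [← Module.End.mul_apply, ((hc i j).pow_left r).symm.eq, Module.End.mul_apply, hSy j hj,
          map_zero]

end Operators

/-- Any set of nonzero degrees that contains a suitable finite set and is closed under sums of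
independent degrees contains all nonzero degrees. -/
lemma exists_finite_base {M : AddSubgroup (Fin n → ℤ)} {k₁ k₂ : Fin n → ℤ} (h₁ : k₁ ∈ M)
    (h₂ : k₂ ∈ M) (h : Indep k₁ k₂) :
    ∃ H : Finset (Fin n → ℤ), (∀ m ∈ H, m ∈ M ∧ m ≠ 0) ∧ ∀ P : (Fin n → ℤ) → Prop,
      (∀ m ∈ H, P m) → (∀ x ∈ M, ∀ y ∈ M, Indep x y → P x → P y → P (x + y)) →
      ∀ m ∈ M, m ≠ 0 → P m := by
  classical
  obtain ⟨F, hF⟩ : M.FG :=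
    (Submodule.fg_iff_addSubgroup_fg (AddSubgroup.toIntSubmodule M)).mp (IsNoetherian.noetherian _)
  let T : Finset (Fin n → ℤ) := {0, k₁, k₂}
  have hT : ∀ j, j ∈ T ↔ j = 0 ∨ j = k₁ ∨ j = k₂ := by simp [T]
  have hTM : ∀ j ∈ T, j ∈ M := fun j hj => by
    rcases (hT j).mp hj with rfl | rfl | rfl
    exacts [M.zero_mem, h₁, h₂]
  have hFM : ∀ f ∈ F, f ∈ M := fun f hf => hF ▸ AddSubgroup.subset_closure hf
  let F' : Finset (Fin n → ℤ) := insert 0 (F ∪ F.image Neg.neg)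
  have hF'M : ∀ f ∈ F', f ∈ M := fun f hf => by
    simp only [F', Finset.mem_insert, Finset.mem_union, Finset.mem_image] at hf
    rcases hf with rfl | hf | ⟨g, hg, rfl⟩
    exacts [M.zero_mem, hFM f hf, M.neg_mem (hFM g hg)]
  let H : Finset (Fin n → ℤ) :=
    ((F' ×ˢ T ×ˢ T).image fun x => x.1 + x.2.1 - x.2.2).filter (· ≠ 0)
  have hH : ∀ f ∈ F', ∀ i ∈ T, ∀ j ∈ T, f + i - j ≠ 0 → f + i - j ∈ H := fun f hf i hi j hj h0 =>
    Finset.mem_filter.mpr ⟨Finset.mem_image.mpr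
      ⟨(f, i, j), by simp only [Finset.mem_product]; exact ⟨hf, hi, hj⟩, rfl⟩, h0⟩
  refine ⟨H, fun m hm => ?_, fun P hP hadd => ?_⟩
  · obtain ⟨hm, h0⟩ := Finset.mem_filter.mp hm
    obtain ⟨x, hx, rfl⟩ := Finset.mem_image.mp hm
    simp only [Finset.mem_product] at hx
    exact ⟨M.sub_mem (M.add_mem (hF'M _ hx.1) (hTM _ hx.2.1)) (hTM _ hx.2.2), h0⟩
  · have h0T : (0 : Fin n → ℤ) ∈ T := by simp [T]
    have h0F : (0 : Fin n → ℤ) ∈ F' := Finset.mem_insert_self _ _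
    have hF₁ : ∀ f ∈ F, f ∈ F' := fun f hf =>
      Finset.mem_insert_of_mem (Finset.mem_union_left _ hf)
    have hF₂ : ∀ f ∈ F, -f ∈ F' := fun f hf =>
      Finset.mem_insert_of_mem (Finset.mem_union_right _ (Finset.mem_image_of_mem _ hf))
    clear_value H F' T
    have step : ∀ m ∈ M, ∀ f ∈ F', (∀ j ∈ T, m + j ≠ 0 → P (m + j)) →
        ∀ j ∈ T, m + f + j ≠ 0 → P (m + f + j) := by
      intro m hm f hf ih j' hj' ht
      obtain ⟨j, hj, hind⟩ := h.exists_indep_add ht m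
      have hj : j ∈ T := (hT j).mpr hj
      have hind' := hind.sub_right
      have e : m + f + j' - (m + j) = f + j' - j := by abel
      have := hadd _ (M.add_mem hm (hTM j hj)) _
        (M.sub_mem (M.add_mem (M.add_mem hm (hF'M f hf)) (hTM j' hj')) (M.add_mem hm (hTM j hj)))
        hind' (ih j hj hind.ne_zero_left)
        (hP _ (e ▸ hH f hf j' hj' j hj (e ▸ hind'.ne_zero_right)))
      rwa [add_sub_cancel] at this
    have all : ∀ m, m ∈ AddSubgroup.closure (F : Set (Fin n → ℤ)) →
        ∀ j ∈ T, m + j ≠ 0 → P (m + j) := by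
      intro m hm
      induction hm using AddSubgroup.closure_induction_right with
      | zero =>
        intro j hj h0
        refine hP _ ?_
        simpa using hH 0 h0F j hj 0 h0T (by simpa using h0)
      | add_right x hx y hy ih => exact step x (hF ▸ hx) y (hF₁ y hy) ih
      | add_neg_cancel x hx y hy ih => exact step x (hF ▸ hx) (-y) (hF₂ y hy) ih
    intro m hm h0
    simpa using all m (hF ▸ hm) 0 h0T (by simpa using h0)

/-- A proper ideal of a Noetherian ring has an associated prime. -/
lemma exists_isPrime_colon {B : Type*} [CommRing B] [IsNoetherianRing B] {J : Ideal B}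
    (hJ : J ≠ ⊤) : ∃ p : Ideal B, p.IsPrime ∧ ∃ a ∉ J, ∀ b, b ∈ p ↔ b * a ∈ J := by
  have : Nontrivial (B ⧸ J) := Ideal.Quotient.nontrivial_iff.mpr hJ
  obtain ⟨p, hp⟩ := associatedPrimes.nonempty B (B ⧸ J)
  obtain ⟨hp, x, hx⟩ := isAssociatedPrime_iff.mp hp
  obtain ⟨a, rfl⟩ := Ideal.Quotient.mk_surjective x
  have key : ∀ b, b ∈ p ↔ b * a ∈ J := fun b => by
    rw [hx, Submodule.mem_colon_singleton, Submodule.mem_bot, ← Ideal.Quotient.eq_zero_iff_mem,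
      map_mul]
    rfl
  exact ⟨p, hp, a, fun ha => hp.ne_top ((Ideal.eq_top_iff_one p).mpr ((key 1).mpr (by simpa))), key⟩

/-- A nilpotent element of a quotient of dimension at most `q`. -/
lemma pow_mem_of_finrank_quotient_le {B : Type*} [CommRing B] [Algebra ℂ B] {I : Ideal B}
    [FiniteDimensional ℂ (B ⧸ I)] {q : ℕ} (hq : Module.finrank ℂ (B ⧸ I) ≤ q) {b : B} {r : ℕ}
    (hb : b ^ r ∈ I) : b ^ q ∈ I := by
  rw [← Ideal.Quotient.eq_zero_iff_mem, map_pow] at hb ⊢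
  have h := pow_eq_zero_of_finrank_le (f := Algebra.lmul ℂ (B ⧸ I) (Ideal.Quotient.mk I b))
    ⟨r, by rw [← map_pow, hb, map_zero]⟩ hq
  rw [← map_pow] at h
  simpa using LinearMap.congr_fun h 1

/-- A prime ideal containing an ideal of finite codimension has residue field `ℂ`. -/
lemma exists_sub_mem_of_finiteDimensional {B : Type*} [CommRing B] [Algebra ℂ B] {I p : Ideal B}
    [FiniteDimensional ℂ (B ⧸ I)] (hp : p.IsPrime) (h : I ≤ p) (b : B) :
    ∃ c : ℂ, b - algebraMap ℂ B c ∈ p := by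
  have : FiniteDimensional ℂ (B ⧸ p) :=
    Module.Finite.of_surjective (Ideal.Quotient.factorₐ ℂ h).toLinearMap
      (Ideal.Quotient.factor_surjective h)
  obtain ⟨c, hc⟩ := (IsAlgClosed.algebraMap_bijective_of_isIntegral (k := ℂ) (K := B ⧸ p)).2
    (Ideal.Quotient.mk p b)
  refine ⟨c, ?_⟩
  rw [← Ideal.Quotient.eq_zero_iff_mem, map_sub, ← hc, sub_eq_zero]
  rfl

/-- An ideal that is the kernel of a linear map to `V` has codimension at most `dim V`. -/
lemma finrank_quotient_le_of_ker {B V : Type*} [CommRing B] [Algebra ℂ B] [AddCommGroup V]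
    [Module ℂ V] [FiniteDimensional ℂ V] (Φ : B →ₗ[ℂ] V) {I : Ideal B}
    (h : ∀ b, b ∈ I ↔ Φ b = 0) :
    FiniteDimensional ℂ (B ⧸ I) ∧ Module.finrank ℂ (B ⧸ I) ≤ Module.finrank ℂ V := by
  have hker : LinearMap.ker Φ = I.restrictScalars ℂ := by
    ext b
    rw [LinearMap.mem_ker, Submodule.restrictScalars_mem, h]
  let e : (B ⧸ I) ≃ₗ[ℂ] LinearMap.range Φ :=
    (Submodule.Quotient.restrictScalarsEquiv ℂ I).symm ≪≫ₗ
      (Submodule.quotEquivOfEq _ _ hker.symm) ≪≫ₗ Φ.quotKerEquivRange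
  exact ⟨Module.Finite.equiv e.symm, e.finrank_eq.trans_le (Submodule.finrank_le _)⟩

section Rep

variable {E : (Fin n → ℤ) → 𝔤 →ₗ[ℂ] τ} {K W : (Fin n → ℤ) → Fin n → τ}
variable {B : Type} [CommRing B] [Algebra ℂ B] {X : Type} [AddCommGroup X] [Module ℂ X]

/-- The weight space of weight `l` for the operators `ρ(1 ⊗ dᵢ)`. -/
noncomputable def wt (W : (Fin n → ℤ) → Fin n → τ) (ρ : B →ₗ[ℂ] τ →ₗ[ℂ] Module.End ℂ X)
    (l : Fin n → ℂ) : Submodule ℂ X :=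
  ⨅ v : Fin n → ℂ, LinearMap.ker (ρ 1 (lin W 0 v) - (v ⬝ᵥ l) • LinearMap.id)

lemma mem_wt {ρ : B →ₗ[ℂ] τ →ₗ[ℂ] Module.End ℂ X} {l : Fin n → ℂ} {x : X} :
    x ∈ wt W ρ l ↔ ∀ v, ρ 1 (lin W 0 v) x = (v ⬝ᵥ l) • x := by
  simp [wt, Submodule.mem_iInf, sub_eq_zero]

/-- A subspace stable under all operators `ρ(b ⊗ Y)` with `Y` homogeneous of degree in `M`. -/
def IsStable (E : (Fin n → ℤ) → 𝔤 →ₗ[ℂ] τ) (K W : (Fin n → ℤ) → Fin n → τ)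
    (M : AddSubgroup (Fin n → ℤ)) (ρ : B →ₗ[ℂ] τ →ₗ[ℂ] Module.End ℂ X)
    (U : Submodule ℂ X) : Prop :=
  ∀ b, ∀ m ∈ M, ∀ Y ∈ homog E K W m, ∀ x ∈ U, ρ b Y x ∈ U

/-- `ρ` defines an irreducible representation of `τ(B)_M` whose weight spaces have dimension at
most `N`. -/
structure IsCuspidalRep (E : (Fin n → ℤ) → 𝔤 →ₗ[ℂ] τ) (K W : (Fin n → ℤ) → Fin n → τ)
    (M : AddSubgroup (Fin n → ℤ)) (ρ : B →ₗ[ℂ] τ →ₗ[ℂ] Module.End ℂ X) (N : ℕ) : Prop where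
  comm : ∀ {m k : Fin n → ℤ}, m ∈ M → k ∈ M → ∀ {Y Z : τ}, Y ∈ homog E K W m →
    Z ∈ homog E K W k → ∀ a b, ρ a Y * ρ b Z - ρ b Z * ρ a Y = ρ (a * b) ⁅Y, Z⁆
  eq_top_of_isStable : ∀ U, IsStable E K W M ρ U → U ≠ ⊥ → U = ⊤
  iSup_wt : ⨆ l, wt W ρ l = ⊤
  finite_wt : ∀ l, FiniteDimensional ℂ (wt W ρ l)
  finrank_wt : ∀ l, Module.finrank ℂ (wt W ρ l) ≤ N

/-- The ideal of all `b` with `ρ(cb ⊗ τ_M) = 0` for all `c`. -/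
def annIdeal (E : (Fin n → ℤ) → 𝔤 →ₗ[ℂ] τ) (K W : (Fin n → ℤ) → Fin n → τ)
    (M : AddSubgroup (Fin n → ℤ)) (ρ : B →ₗ[ℂ] τ →ₗ[ℂ] Module.End ℂ X) : Ideal B where
  carrier := {b | ∀ c, ∀ m ∈ M, ∀ Y ∈ homog E K W m, ρ (c * b) Y = 0}
  add_mem' ha hb c m hm Y hY := by
    rw [mul_add, map_add, LinearMap.add_apply, ha c m hm Y hY, hb c m hm Y hY, add_zero]
  zero_mem' c m hm Y hY := by simp
  smul_mem' d b hb c m hm Y hY := by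
    rw [smul_eq_mul, ← mul_assoc]; exact hb (c * d) m hm Y hY

namespace IsCuspidalRep

variable {M : AddSubgroup (Fin n → ℤ)} {ρ : B →ₗ[ℂ] τ →ₗ[ℂ] Module.End ℂ X} {N : ℕ}
variable (hρ : IsCuspidalRep E K W M ρ N)
variable {κ : 𝔤 →ₗ[ℂ] 𝔤 →ₗ[ℂ] ℂ} {c₁ c₂ : ℂ} (hτ : IsFullToroidal n 𝔤 τ κ c₁ c₂ E K W)
include hρ

lemma comm_apply {m k : Fin n → ℤ} (hm : m ∈ M) (hk : k ∈ M) {Y Z : τ}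
    (hY : Y ∈ homog E K W m) (hZ : Z ∈ homog E K W k) (a b : B) (x : X) :
    ρ a Y (ρ b Z x) = ρ b Z (ρ a Y x) + ρ (a * b) ⁅Y, Z⁆ x := by
  rw [← hρ.comm hm hk hY hZ]; simp

/-- If two endomorphisms agree on all weight spaces, they are equal. -/
lemma ext_wt {f g : Module.End ℂ X} (h : ∀ l, ∀ x ∈ wt W ρ l, f x = g x) : f = g := by
  rw [← sub_eq_zero, ← LinearMap.ker_eq_top, eq_top_iff, ← hρ.iSup_wt, iSup_le_iff]
  intro l x hx
  simp [h l x hx]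

/-- Nilpotency on each weight space is uniform. -/
lemma pow_eq_zero {f : Module.End ℂ X} (hf : ∀ l, ∀ x ∈ wt W ρ l, f x ∈ wt W ρ l)
    (hnil : ∀ l, IsNilpotent (f.restrict (hf l))) : f ^ N = 0 := by
  refine hρ.ext_wt fun l x hx => ?_
  have := hρ.finite_wt l
  have h := pow_eq_zero_of_finrank_le (hnil l) (hρ.finrank_wt l)
  rw [Module.End.pow_restrict] at h
  simpa using congrArg Subtype.val (LinearMap.congr_fun h ⟨x, hx⟩)

/-- A degree zero operator which is an eigenvector, with nonzero eigenvalue, for the commutator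
with another degree zero operator is nilpotent. -/
lemma pow_eq_zero_of_eigenvector {f h : Module.End ℂ X}
    (hf : ∀ l, ∀ x ∈ wt W ρ l, f x ∈ wt W ρ l) (hh : ∀ l, ∀ x ∈ wt W ρ l, h x ∈ wt W ρ l)
    {α : ℂ} (hα : α ≠ 0) (hc : h * f - f * h = α • f) : f ^ N = 0 := by
  refine hρ.pow_eq_zero hf fun l => ?_
  have := hρ.finite_wt l
  refine isNilpotent_of_commutator (h := h.restrict (hh l)) hα ?_
  ext x
  simpa using LinearMap.congr_fun hc x

include hτ

lemma map_wt {m : Fin n → ℤ} (hm : m ∈ M) {Y : τ} (hY : Y ∈ homog E K W m) (a : B)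
    {l : Fin n → ℂ} {x : X} (hx : x ∈ wt W ρ l) : ρ a Y x ∈ wt W ρ (l + toC m) := by
  rw [mem_wt] at hx ⊢
  intro v
  rw [hρ.comm_apply M.zero_mem hm (W_mem_homog 0 v) hY, hx v, hτ.lie_degree_s4 hY, one_mul, map_smul,
    map_smul, LinearMap.smul_apply, dotProduct_add, add_smul]

lemma map_wt_zero {Y : τ} (hY : Y ∈ homog E K W 0) (a : B) (l : Fin n → ℂ) :
    ∀ x ∈ wt W ρ l, ρ a Y x ∈ wt W ρ l := fun x hx => by
  simpa [toC_zero] using hρ.map_wt hτ M.zero_mem hY a hx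

/-- An ideal killing a nonzero vector kills everything. -/
lemma le_annIdeal {I : Ideal B} {x : X} (hx : x ≠ 0)
    (h : ∀ b ∈ I, ∀ m ∈ M, ∀ Y ∈ homog E K W m, ρ b Y x = 0) : I ≤ annIdeal E K W M ρ := by
  let U : Submodule ℂ X :=
    { carrier := {x | ∀ b ∈ I, ∀ m ∈ M, ∀ Y ∈ homog E K W m, ρ b Y x = 0}
      add_mem' := fun hx hy b hb m hm Y hY => by
        rw [map_add, hx b hb m hm Y hY, hy b hb m hm Y hY, add_zero]
      zero_mem' := fun b _ m _ Y _ => map_zero _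
      smul_mem' := fun c x hx b hb m hm Y hY => by
        rw [map_smul, hx b hb m hm Y hY, smul_zero] }
  have hU : U = ⊤ := by
    refine hρ.eq_top_of_isStable U (fun a k hk Z hZ y hy b hb m hm Y hY => ?_)
      ((Submodule.ne_bot_iff _).mpr ⟨x, h, hx⟩)
    rw [hρ.comm_apply hm hk hY hZ, hy b hb m hm Y hY, map_zero, zero_add]
    exact hy _ (I.mul_mem_right a hb) _ (M.add_mem hm hk) _ (hτ.lie_mem_homog hY hZ)
  intro b hb c m hm Y hY
  ext y
  have hy : y ∈ U := by rw [hU]; trivial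
  exact hy _ (I.mul_mem_left c hb) m hm Y hY

/-- In nonzero degree `m`, the elements `b` with `ρ(b ⊗ τ_m) = 0` on a given weight space form an
ideal of bounded codimension. -/
lemma exists_killing_ideal [FiniteDimensional ℂ 𝔤] {m : Fin n → ℤ} (hm : m ∈ M) (hm0 : m ≠ 0)
    (l : Fin n → ℂ) : ∃ I : Ideal B,
      (∀ b, b ∈ I ↔ ∀ Y ∈ homog E K W m, ∀ x ∈ wt W ρ l, ρ b Y x = 0) ∧
      FiniteDimensional ℂ (B ⧸ I) ∧
      Module.finrank ℂ (B ⧸ I) ≤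
        Module.finrank ℂ (𝔤 × (Fin n → ℂ) × (Fin n → ℂ)) * (N * N) := by
  obtain ⟨v, hv⟩ := exists_generic n
  let I : Ideal B :=
    { carrier := {b | ∀ Y ∈ homog E K W m, ∀ x ∈ wt W ρ l, ρ b Y x = 0}
      add_mem' := fun {a b} ha hb Y hY x hx => by
        rw [map_add, LinearMap.add_apply, LinearMap.add_apply, ha Y hY x hx, hb Y hY x hx,
          add_zero]
      zero_mem' := fun Y _ x _ => by simp
      smul_mem' := fun c b hb Y hY x hx => by
        have h := hρ.comm_apply M.zero_mem hm (W_mem_homog 0 v) hY c b x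
        rw [hb Y hY x hx, hb Y hY _ (hρ.map_wt_zero hτ (W_mem_homog 0 v) c l x hx),
          hτ.lie_degree_s4 hY, map_zero, zero_add, map_smul, LinearMap.smul_apply, eq_comm,
          smul_eq_zero] at h
        exact h.resolve_left (hv m hm0) }
  have hmap := fun (b : B) γ x (hx : x ∈ wt W ρ l) =>
    hρ.map_wt hτ hm (LinearMap.mem_range_self (homogMap E K W m) γ) b hx
  let Φ : B →ₗ[ℂ] (𝔤 × (Fin n → ℂ) × (Fin n → ℂ)) →ₗ[ℂ]
      wt W ρ l →ₗ[ℂ] wt W ρ (l + toC m) :=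
    LinearMap.mk₂ ℂ (fun b γ => (ρ b (homogMap E K W m γ)).restrict (hmap b γ))
      (fun _ _ _ => by ext; simp) (fun _ _ _ => by ext; simp)
      (fun _ _ _ => by ext; simp) (fun _ _ _ => by ext; simp)
  have hker : ∀ b, b ∈ I ↔ Φ b = 0 := fun b => by
    constructor
    · exact fun h => LinearMap.ext fun γ => LinearMap.ext fun x =>
        Subtype.ext (h _ ⟨γ, rfl⟩ x x.2)
    · rintro h _ ⟨γ, rfl⟩ x hx
      exact congrArg Subtype.val (LinearMap.congr_fun (LinearMap.congr_fun h γ) ⟨x, hx⟩)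
  have := hρ.finite_wt l
  have := hρ.finite_wt (l + toC m)
  clear_value Φ
  obtain ⟨hfin, hle⟩ := finrank_quotient_le_of_ker (I := I)
    (V := (𝔤 × (Fin n → ℂ) × (Fin n → ℂ)) →ₗ[ℂ] wt W ρ l →ₗ[ℂ] wt W ρ (l + toC m)) Φ hker
  refine ⟨I, fun b => Iff.rfl, hfin, hle.trans ?_⟩
  rw [Module.finrank_linearMap, Module.finrank_linearMap]
  exact Nat.mul_le_mul_left _ (Nat.mul_le_mul (hρ.finrank_wt _) (hρ.finrank_wt _))

omit hρ hτ in
lemma exists_wt_ne_bot [Nontrivial X] (h : ⨆ l, wt W ρ l = ⊤) : ∃ l, wt W ρ l ≠ ⊥ := by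
  by_contra! hbot
  simp [hbot] at h

omit hτ in
lemma kills_lie {x : X} {I₁ I₂ : Ideal B} {m k : Fin n → ℤ} (hm : m ∈ M) (hk : k ∈ M) {Y Z : τ}
    (hY : Y ∈ homog E K W m) (hZ : Z ∈ homog E K W k) (h₁ : ∀ b ∈ I₁, ρ b Y x = 0)
    (h₂ : ∀ b ∈ I₂, ρ b Z x = 0) : ∀ b ∈ I₁ * I₂, ρ b ⁅Y, Z⁆ x = 0 := by
  intro b hb
  induction hb using Submodule.mul_induction_on' with
  | mem_mul_mem a ha b hb =>
    rw [← hρ.comm hm hk hY hZ]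
    simp [h₁ a ha, h₂ b hb]
  | add a _ b _ ha hb => rw [map_add, LinearMap.add_apply, LinearMap.add_apply, ha, hb, add_zero]

omit hρ hτ in
/-- Passing from generators of a subspace of `τ` to the subspace, for annihilation of `x`. -/
lemma kills_of_le {x : X} {I : Ideal B} {S : Submodule ℂ τ}
    (h : ∀ U : Submodule ℂ τ, (∀ Y, Y ∈ U ↔ ∀ b ∈ I, ρ b Y x = 0) → S ≤ U) :
    ∀ b ∈ I, ∀ Y ∈ S, ρ b Y x = 0 := by
  let U : Submodule ℂ τ :=
    { carrier := {Y | ∀ b ∈ I, ρ b Y x = 0}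
      add_mem' := fun hY hZ b hb => by
        rw [map_add, LinearMap.add_apply, hY b hb, hZ b hb, add_zero]
      zero_mem' := fun b _ => by simp
      smul_mem' := fun c Y hY b hb => by
        rw [map_smul, LinearMap.smul_apply, hY b hb, smul_zero] }
  exact fun b hb Y hY => h U (fun Y => Iff.rfl) hY b hb

lemma kills_add {x : X} {I₁ I₂ : Ideal B} {m k : Fin n → ℤ} (hm : m ∈ M) (hk : k ∈ M)
    (hmk : Indep m k) (h₁ : ∀ b ∈ I₁, ∀ Y ∈ homog E K W m, ρ b Y x = 0)
    (h₂ : ∀ b ∈ I₂, ∀ Y ∈ homog E K W k, ρ b Y x = 0) :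
    ∀ b ∈ I₁ * I₂, ∀ Y ∈ homog E K W (m + k), ρ b Y x = 0 :=
  kills_of_le fun _ hU => hτ.homog_le_of_indep hmk fun Y hY Z hZ => (hU _).mpr <|
    hρ.kills_lie hm hk hY hZ (fun b hb => h₁ b hb Y hY) (fun b hb => h₂ b hb Z hZ)

variable {k₁ k₂ : Fin n → ℤ} (h₁ : k₁ ∈ M) (h₂ : k₂ ∈ M) (hind : Indep k₁ k₂)
include h₁ h₂ hind

lemma kills_zero {x : X} {I : Ideal B}
    (h : ∀ m ∈ M, m ≠ 0 → ∀ b ∈ I, ∀ Y ∈ homog E K W m, ρ b Y x = 0) :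
    ∀ b ∈ I * I, ∀ Y ∈ homog E K W 0, ρ b Y x = 0 :=
  kills_of_le fun _ hU => hτ.homog_zero_le hind fun k hk Y hY Z hZ _ => by
    have hkM : k ∈ M := by rcases hk with rfl | rfl <;> assumption
    have hk0 : k ≠ 0 := by
      rcases hk with rfl | rfl
      exacts [hind.ne_zero_left, hind.ne_zero_right]
    exact (hU _).mpr <| hρ.kills_lie (M.neg_mem hkM) hkM hY hZ
      (fun b hb => h _ (M.neg_mem hkM) (neg_ne_zero.mpr hk0) b hb Y hY)
      (fun b hb => h _ hkM hk0 b hb Z hZ)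

/-- Prime ideals above the annihilator have residue field `ℂ`. -/
lemma exists_sub_mem [FiniteDimensional ℂ 𝔤] [Nontrivial X] {p : Ideal B} (hp : p.IsPrime)
    (hJ : annIdeal E K W M ρ ≤ p) (b : B) : ∃ c : ℂ, b - algebraMap ℂ B c ∈ p := by
  obtain ⟨l, hl⟩ := exists_wt_ne_bot hρ.iSup_wt
  obtain ⟨x, hxl, hx⟩ := Submodule.exists_mem_ne_zero_of_ne_bot hl
  have hex : ∀ m : Fin n → ℤ, ∃ I : Ideal B, m ∈ M → m ≠ 0 → _ := fun m => by
    by_cases h : m ∈ M ∧ m ≠ 0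
    · obtain ⟨I, hI⟩ := hρ.exists_killing_ideal hτ h.1 h.2 l
      exact ⟨I, fun _ _ => hI⟩
    · exact ⟨⊤, fun h1 h2 => (h ⟨h1, h2⟩).elim⟩
  choose I hI using hex
  set q := Module.finrank ℂ (𝔤 × (Fin n → ℂ) × (Fin n → ℂ)) * (N * N)
  obtain ⟨H, hHM, hH⟩ := exists_finite_base h₁ h₂ hind
  let I₀ : Ideal B := H.inf I
  have hpow : ∀ m ∈ M, m ≠ 0 → ∃ r, I₀ ^ r ≤ I m := fun m hm hm0 => by
    obtain ⟨r, hr⟩ := hH (fun m => ∃ r : ℕ, ∀ x ∈ wt W ρ l, ∀ b ∈ I₀ ^ r,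
      ∀ Y ∈ homog E K W m, ρ b Y x = 0)
      (fun m hm => ⟨1, fun x hx b hb Y hY =>
        ((hI m (hHM m hm).1 (hHM m hm).2).1 b).mp
          ((Finset.inf_le hm : I₀ ≤ I m) (by rwa [pow_one] at hb)) Y hY x hx⟩)
      (fun m hm k hk hmk ⟨r, hr⟩ ⟨s, hs⟩ => ⟨r + s, fun x hx b hb =>
        hρ.kills_add hτ hm hk hmk (hr x hx) (hs x hx) b (by rwa [pow_add] at hb)⟩) m hm hm0
    exact ⟨r, fun b hb => ((hI m hm hm0).1 b).mpr fun Y hY x hx => hr x hx b hb Y hY⟩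
  let I' : Ideal B := Ideal.span {b | ∃ a ∈ I₀, b = a ^ q}
  have hI' : ∀ m ∈ M, m ≠ 0 → I' ≤ I m := fun m hm hm0 => by
    obtain ⟨r, hr⟩ := hpow m hm hm0
    obtain ⟨-, hfin, hle⟩ := hI m hm hm0
    rw [Ideal.span_le]
    rintro _ ⟨a, ha, rfl⟩
    exact pow_mem_of_finrank_quotient_le hle (hr (Ideal.pow_mem_pow ha r))
  have hkill : ∀ m ∈ M, m ≠ 0 → ∀ b ∈ I', ∀ Y ∈ homog E K W m, ρ b Y x = 0 :=
    fun m hm hm0 b hb Y hY => ((hI m hm hm0).1 b).mp (hI' m hm hm0 hb) Y hY x hxl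
  have hI'J : I' * I' ≤ p := (hρ.le_annIdeal hτ hx fun b hb m hm Y hY => by
    by_cases hm0 : m = 0
    · subst hm0
      exact hρ.kills_zero hτ h₁ h₂ hind hkill b hb Y hY
    · exact hkill m hm hm0 b (Ideal.mul_le_left hb) Y hY).trans hJ
  have hI'p : I' ≤ p := (hp.mul_le.mp hI'J).elim id id
  have hI₀ : I₀ ≤ p := fun b hb =>
    hp.mem_of_pow_mem q (hI'p (Ideal.subset_span ⟨b, hb, rfl⟩))
  obtain ⟨m, hm, hmp⟩ := hp.inf_le'.mp hI₀
  obtain ⟨-, hfin, -⟩ := hI m (hHM m hm).1 (hHM m hm).2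
  exact exists_sub_mem_of_finiteDimensional hp hmp b

section SquareZero

variable {a : B} (ha : ∀ b, ∃ c : ℂ, ∀ m ∈ M, ∀ Y ∈ homog E K W m, ρ (b * a) Y = c • ρ a Y)
  (haa : ∀ m ∈ M, ∀ Y ∈ homog E K W m, ρ (a * a) Y = 0)
include haa

omit h₁ h₂ hind in
lemma commute_of_sq {m k : Fin n → ℤ} (hm : m ∈ M) (hk : k ∈ M) {Y Z : τ}
    (hY : Y ∈ homog E K W m) (hZ : Z ∈ homog E K W k) : Commute (ρ a Y) (ρ a Z) := by
  rw [Commute, SemiconjBy, ← sub_eq_zero, hρ.comm hm hk hY hZ,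
    haa _ (M.add_mem hm hk) _ (hτ.lie_mem_homog hY hZ)]

include ha

omit h₁ h₂ hind in
/-- In the square-zero case, the degree zero operators `ρ(a ⊗ d_v)` are unipotent up to a
scalar. -/
lemma exists_pow_sub_eq_zero [Nontrivial X] (v : Fin n → ℂ) :
    ∃ c : ℂ, (ρ a (lin W 0 v) - algebraMap ℂ (Module.End ℂ X) c) ^ N = 0 := by
  set w := ρ a (lin W 0 v) with hw
  have hwt := hρ.map_wt_zero hτ (W_mem_homog 0 v) a
  obtain ⟨l, hl⟩ := exists_wt_ne_bot hρ.iSup_wt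
  have := hρ.finite_wt l
  have := Submodule.nontrivial_iff_ne_bot.mpr hl
  obtain ⟨c, hc⟩ := Module.End.exists_eigenvalue (w.restrict (hwt l))
  obtain ⟨x, hx⟩ := hc.exists_hasEigenvector
  refine ⟨c, ?_⟩
  set g := w - algebraMap ℂ (Module.End ℂ X) c with hg
  have hU : w.maxGenEigenspace c = ⊤ := by
    refine hρ.eq_top_of_isStable _ (fun b m hm Z hZ y hy => ?_)
      ((Submodule.ne_bot_iff _).mpr ⟨x, ?_, fun h => hx.2 (Subtype.ext h)⟩)
    · rw [Module.End.mem_maxGenEigenspace] at hy ⊢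
      obtain ⟨s, hs⟩ := hy
      rw [Algebra.smul_def, mul_one, ← hg] at hs ⊢
      obtain ⟨d, hd⟩ := ha b
      have hcomm : ρ b Z * g - g * ρ b Z = (-(d * (v ⬝ᵥ toC m))) • ρ a Z := by
        rw [hg, mul_sub, sub_mul, Algebra.commutes c, sub_sub_sub_cancel_right,
          hρ.comm hm M.zero_mem hZ (W_mem_homog 0 v), ← lie_skew, hτ.lie_degree_s4 hZ, map_neg,
          map_smul, hd m hm Z hZ, smul_smul, neg_smul, mul_comm]
      have hgy : Commute g ((-(d * (v ⬝ᵥ toC m))) • ρ a Z) :=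
        (((hρ.commute_of_sq hτ haa M.zero_mem hm (W_mem_homog 0 v) hZ).sub_left
          (Algebra.commutes c _)).smul_right _)
      have h := mul_pow_succ_of_commutator hcomm hgy s
      rw [(hgy.pow_left s).eq] at h
      refine ⟨s + 1, ?_⟩
      have h' := LinearMap.congr_fun h y
      simp only [Module.End.mul_apply, LinearMap.add_apply, LinearMap.smul_apply, hs, map_zero,
        smul_zero, add_zero, pow_succ'] at h'
      rw [pow_succ']
      exact h'.symm
    · rw [Module.End.mem_maxGenEigenspace]
      refine ⟨1, ?_⟩
      have := congrArg Subtype.val hx.apply_eq_smul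
      simpa [sub_eq_zero] using this
  have hgwt : ∀ l, ∀ x ∈ wt W ρ l, g x ∈ wt W ρ l := fun l x hx => by
    rw [hg, LinearMap.sub_apply, Module.algebraMap_end_apply]
    exact Submodule.sub_mem _ (hwt l x hx) (Submodule.smul_mem _ c hx)
  refine hρ.pow_eq_zero hgwt fun l => ?_
  have := hρ.finite_wt l
  rw [Module.End.isNilpotent_iff_of_finite]
  intro y
  have hy : (y : X) ∈ w.maxGenEigenspace c := by rw [hU]; trivial
  obtain ⟨s, hs⟩ := (Module.End.mem_maxGenEigenspace _ _ _).mp hy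
  rw [Algebra.smul_def, mul_one, ← hg] at hs
  refine ⟨s, Subtype.ext ?_⟩
  rw [Module.End.pow_restrict]
  exact hs

omit h₁ h₂ hind in
lemma isNilpotent_of_ne_zero [Nontrivial X] {m : Fin n → ℤ} (hm : m ∈ M) (hm0 : m ≠ 0) {Y : τ}
    (hY : Y ∈ homog E K W m) : IsNilpotent (ρ a Y) := by
  obtain ⟨v, hv⟩ := exists_generic n
  obtain ⟨c, hc⟩ := hρ.exists_pow_sub_eq_zero hτ ha haa v
  have hvm := hv m hm0
  have h : ρ 1 ((-(v ⬝ᵥ toC m))⁻¹ • Y) * (ρ a (lin W 0 v) - algebraMap ℂ (Module.End ℂ X) c) -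
      (ρ a (lin W 0 v) - algebraMap ℂ (Module.End ℂ X) c) * ρ 1 ((-(v ⬝ᵥ toC m))⁻¹ • Y) =
      ρ a Y := by
    rw [mul_sub, sub_mul, Algebra.commutes c, sub_sub_sub_cancel_right,
      hρ.comm hm M.zero_mem (Submodule.smul_mem _ _ hY) (W_mem_homog 0 v), ← lie_skew, lie_smul,
      hτ.lie_degree_s4 hY, smul_smul, ← neg_smul, one_mul, inv_neg, neg_mul, neg_neg,
      inv_mul_cancel₀ hvm, one_smul]
  refine ⟨N, pow_eq_zero_of_commutator h ?_ ?_ hc⟩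
  · exact (hρ.commute_of_sq hτ haa M.zero_mem hm (W_mem_homog 0 v) hY).sub_left
      (Algebra.commutes c _)
  · rw [Commute, SemiconjBy, ← sub_eq_zero, hρ.comm hm hm (Submodule.smul_mem _ _ hY) hY, smul_lie,
      lie_self, smul_zero, map_zero]

lemma isNilpotent_of_zero [Nontrivial X] {Y : τ} (hY : Y ∈ homog E K W 0) :
    IsNilpotent (ρ a Y) := by
  let U : Submodule ℂ τ :=
    { carrier := {Y | Y ∈ homog E K W 0 ∧ IsNilpotent (ρ a Y)}
      add_mem' := fun ⟨hY, hYn⟩ ⟨hZ, hZn⟩ => ⟨Submodule.add_mem _ hY hZ, by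
        rw [map_add]
        exact (hρ.commute_of_sq hτ haa M.zero_mem M.zero_mem hY hZ).isNilpotent_add hYn hZn⟩
      zero_mem' := ⟨Submodule.zero_mem _, by rw [map_zero]; exact .zero⟩
      smul_mem' := fun c Y ⟨hY, hYn⟩ => ⟨Submodule.smul_mem _ c hY, by
        rw [map_smul]; exact hYn.smul c⟩ }
  refine (hτ.homog_zero_le (U := U) hind (fun k hk P hP Q hQ hPQ => ?_) hY).2
  have hkM : k ∈ M := by rcases hk with rfl | rfl <;> assumption
  have hk0 : k ≠ 0 := by
    rcases hk with rfl | rfl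
    exacts [hind.ne_zero_left, hind.ne_zero_right]
  have hPQ0 := hτ.lie_mem_homog hP hQ
  obtain ⟨s, hs⟩ := hρ.isNilpotent_of_ne_zero hτ ha haa hkM hk0 hQ
  have hcomm := hρ.comm (M.neg_mem hkM) hkM hP hQ 1 a
  rw [one_mul] at hcomm
  refine ⟨by rwa [neg_add_cancel] at hPQ0, s, pow_eq_zero_of_commutator hcomm ?_ ?_ hs⟩
  · exact hρ.commute_of_sq hτ haa hkM (M.add_mem (M.neg_mem hkM) hkM) hQ hPQ0
  · rw [Commute, SemiconjBy, ← sub_eq_zero,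
      hρ.comm (M.neg_mem hkM) (M.add_mem (M.neg_mem hkM) hkM) hP hPQ0, hPQ, map_zero]

/-- The square-zero case: the operators `ρ(a ⊗ Y)` vanish. -/
lemma mem_annIdeal_of_sq [FiniteDimensional ℂ 𝔤] [Nontrivial X] : a ∈ annIdeal E K W M ρ := by
  classical
  obtain ⟨u, hu⟩ := exists_generic n
  set w := ρ a (lin W 0 u) with hw
  have hex : ∃ r, w ^ r = 0 := hρ.isNilpotent_of_zero hτ h₁ h₂ hind ha haa (W_mem_homog 0 u)
  have h0 : Nat.find hex ≠ 0 := fun h0 => by simpa [h0] using Nat.find_spec hex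
  obtain ⟨r, hr⟩ := Nat.exists_eq_succ_of_ne_zero h0
  have hr0 : w ^ r ≠ 0 := Nat.find_min hex (by omega)
  have hr1 : w ^ (r + 1) = 0 := by
    have := Nat.find_spec hex
    rwa [hr] at this
  have hkill : ∀ m ∈ M, m ≠ 0 → ∀ Y ∈ homog E K W m, w ^ r * ρ a Y = 0 := by
    intro m hm hm0 Y hY
    have hcomm := hρ.comm hm M.zero_mem hY (W_mem_homog 0 u) 1 a
    rw [← lie_skew, hτ.lie_degree_s4 hY, one_mul, ← neg_smul, map_smul] at hcomm
    have h := mul_pow_succ_of_commutator hcomm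
      ((hρ.commute_of_sq hτ haa M.zero_mem hm (W_mem_homog 0 u) hY).smul_right _) r
    rw [← hw, hr1, mul_zero, zero_mul, zero_add, mul_smul_comm, smul_smul, eq_comm,
      smul_eq_zero] at h
    refine h.resolve_left (mul_ne_zero (by exact_mod_cast r.succ_ne_zero) ?_)
    exact neg_ne_zero.mpr (hu m hm0)
  obtain ⟨x, hx⟩ : ∃ x, (w ^ r) x ≠ 0 := by
    by_contra! h
    exact hr0 (LinearMap.ext h)
  have : Module.Finite ℂ (homog E K W 0) := by unfold homog; infer_instance
  obtain ⟨S, hS⟩ := (Module.Finite.fg_top : (⊤ : Submodule ℂ (homog E K W 0)).FG)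
  have hcomm := fun {m : Fin n → ℤ} (hm : m ∈ M) {Y Z : τ} (hY : Y ∈ homog E K W m)
    (hZ : Z ∈ homog E K W 0) => hρ.commute_of_sq hτ haa hm M.zero_mem hY hZ
  obtain ⟨y, hy0, hy, hSy⟩ := exists_common_kernel S (fun Y : homog E K W 0 => ρ a Y)
    (fun Y Z => hcomm M.zero_mem Y.2 Z.2)
    (fun Y => hρ.isNilpotent_of_zero hτ h₁ h₂ hind ha haa Y.2)
    (fun x => ∀ m ∈ M, m ≠ 0 → ∀ Y ∈ homog E K W m, ρ a Y x = 0)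
    (fun Z x hx m hm hm0 Y hY => by
      rw [← Module.End.mul_apply, (hcomm hm hY Z.2).eq, Module.End.mul_apply, hx m hm hm0 Y hY,
        map_zero])
    hx (fun m hm hm0 Y hY => by
      rw [← Module.End.mul_apply, ((hcomm hm hY (W_mem_homog 0 u)).pow_right r).eq,
        hkill m hm hm0 Y hY, LinearMap.zero_apply])
  have hy' : ∀ m ∈ M, ∀ Y ∈ homog E K W m, ρ a Y y = 0 := by
    intro m hm Y hY
    by_cases hm0 : m = 0
    · subst hm0
      have : (⊤ : Submodule ℂ (homog E K W 0)) ≤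
          LinearMap.ker (((ρ a).flip y).comp (homog E K W 0).subtype) := by
        rw [← hS, Submodule.span_le]
        exact hSy
      exact this (x := ⟨Y, hY⟩) trivial
    · exact hy m hm hm0 Y hY
  refine hρ.le_annIdeal hτ (I := Ideal.span {a}) hy0 (fun b hb m hm Y hY => ?_)
    (Ideal.mem_span_singleton_self a)
  obtain ⟨b, rfl⟩ := Ideal.mem_span_singleton'.mp hb
  obtain ⟨c, hc⟩ := ha b
  rw [hc m hm Y hY, LinearMap.smul_apply, hy' m hm Y hY, smul_zero]

end SquareZero

omit h₁ h₂ hind hτ hρ in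
lemma apply_mul_eq_of_sub_mem {b b' : B} (h : b - b' ∈ annIdeal E K W M ρ) (c : B)
    {m : Fin n → ℤ} (hm : m ∈ M) {Y : τ} (hY : Y ∈ homog E K W m) :
    ρ (c * b) Y = ρ (c * b') Y := by
  rw [← sub_eq_zero, ← LinearMap.sub_apply, ← map_sub, ← mul_sub, h c m hm Y hY]

section Idempotent

variable {e : B} (he : e * e - e ∈ annIdeal E K W M ρ)
include he

/-- If `e` is idempotent modulo the annihilator and `ρ(e ⊗ t^k d_u)` is nilpotent for some `k`,
`u` with `u · k ≠ 0`, then `e` is in the annihilator. -/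
lemma mem_annIdeal_of_isNilpotent {k l : Fin n → ℤ} (hk : k ∈ M) (hl : l ∈ M)
    {u w : Fin n → ℂ} (hwk : w ⬝ᵥ toC k = 0) (hwl : w ⬝ᵥ toC l ≠ 0) (huk : u ⬝ᵥ toC k ≠ 0)
    (hnil : IsNilpotent (ρ e (lin W k u))) : e ∈ annIdeal E K W M ρ := by
  have hidem := fun c {m : Fin n → ℤ} (hm : m ∈ M) {Y : τ} (hY : Y ∈ homog E K W m) =>
    apply_mul_eq_of_sub_mem he c hm hY
  have hw0 := W_mem_homog (E := E) (K := K) (W := W) 0 w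
  have hw : IsNilpotent (ρ e (lin W 0 w)) := by
    obtain ⟨s, hs⟩ := hnil
    have hb : ⁅lin W (-k) w, lin W k u⁆ = (u ⬝ᵥ toC k) • lin W 0 w := by
      have := hτ.lin_W_W_neg (k := -k) (u := u) (w := w) (by rw [toC_neg, dotProduct_neg, hwk,
        neg_zero])
      rw [neg_neg, toC_neg, dotProduct_neg] at this
      rw [← lie_skew, this, neg_smul, neg_neg]
    have hy := hρ.comm (M.neg_mem hk) hk (W_mem_homog (-k) w) (W_mem_homog k u) 1 e
    rw [one_mul, hb, map_smul] at hy
    have h := pow_eq_zero_of_commutator hy ?_ ?_ hs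
    · rw [smul_pow, smul_eq_zero] at h
      exact ⟨s, h.resolve_left (pow_ne_zero _ huk)⟩
    · refine Commute.smul_right ?_ _
      rw [Commute, SemiconjBy, eq_comm, ← sub_eq_zero,
        hρ.comm M.zero_mem hk hw0 (W_mem_homog k u), hτ.lie_degree_s4 (W_mem_homog k u), hwk,
        zero_smul, map_zero]
    · refine Commute.smul_right ?_ _
      rw [Commute, SemiconjBy, eq_comm, ← sub_eq_zero,
        hρ.comm M.zero_mem (M.neg_mem hk) hw0 (W_mem_homog (-k) w),
        hτ.lie_degree_s4 (W_mem_homog (-k) w), toC_neg, dotProduct_neg, hwk, neg_zero, zero_smul,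
        map_zero]
  have hvan : ∀ m ∈ M, w ⬝ᵥ toC m ≠ 0 → ∀ b ∈ Ideal.span {e}, ∀ Y ∈ homog E K W m,
      ρ b Y = 0 := by
    intro m hm hwm b hb Y hY
    obtain ⟨c, rfl⟩ := Ideal.mem_span_singleton'.mp hb
    refine eq_zero_of_isNilpotent_commutator hwm hw ?_
    rw [hρ.comm M.zero_mem hm hw0 hY, hτ.lie_degree_s4 hY, map_smul,
      show e * (c * e) = c * (e * e) by ring, hidem c hm hY]
  have hsq : ∀ {m : Fin n → ℤ}, m ∈ M → ∀ x, (∀ b ∈ Ideal.span {e} * Ideal.span {e},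
      ∀ Y ∈ homog E K W m, ρ b Y x = 0) → ∀ b ∈ Ideal.span {e}, ∀ Y ∈ homog E K W m,
      ρ b Y x = 0 := by
    intro m hm x h b hb Y hY
    obtain ⟨c, rfl⟩ := Ideal.mem_span_singleton'.mp hb
    rw [← hidem c hm hY]
    exact h _ (Ideal.mul_mem_left _ _ (Ideal.mul_mem_mul (Ideal.mem_span_singleton_self e)
      (Ideal.mem_span_singleton_self e))) Y hY
  have hne : ∀ x, ∀ m ∈ M, m ≠ 0 → ∀ b ∈ Ideal.span {e}, ∀ Y ∈ homog E K W m,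
      ρ b Y x = 0 := by
    intro x m hm hm0
    by_cases hwm : w ⬝ᵥ toC m = 0
    · have hml : Indep l m := by
        by_contra hc
        simp only [Indep, not_exists, not_not] at hc
        refine hm0 (funext fun j => ?_)
        have h0 : (w ⬝ᵥ toC l) * (m j : ℂ) = (l j : ℂ) * (w ⬝ᵥ toC m) := by
          simp only [dotProduct, toC, Finset.sum_mul, Finset.mul_sum]
          refine Finset.sum_congr rfl fun i _ => ?_
          have : (l i * m j : ℂ) = l j * m i := by exact_mod_cast hc i j
          linear_combination w i * this
        rw [hwm, mul_zero, mul_eq_zero] at h0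
        simpa using h0.resolve_left hwl
      have hwml : w ⬝ᵥ toC (m - l) ≠ 0 := by
        rw [sub_eq_add_neg, toC_add, toC_neg, dotProduct_add, dotProduct_neg, hwm, zero_add]
        exact neg_ne_zero.mpr hwl
      have hmlM := M.sub_mem hm hl
      have := hρ.kills_add hτ hl hmlM hml.sub_right (x := x)
        (fun b hb Y hY => by rw [hvan l hl hwl b hb Y hY, LinearMap.zero_apply])
        (fun b hb Y hY => by rw [hvan _ hmlM hwml b hb Y hY, LinearMap.zero_apply])
      rw [add_sub_cancel] at this
      exact hsq hm x this
    · intro b hb Y hY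
      rw [hvan m hm hwm b hb Y hY, LinearMap.zero_apply]
  intro c m hm Y hY
  ext x
  have hce : c * e ∈ Ideal.span {e} := Ideal.mul_mem_left _ _ (Ideal.mem_span_singleton_self e)
  by_cases hm0 : m = 0
  · subst hm0
    exact hsq hm x (hρ.kills_zero hτ h₁ h₂ hind (hne x)) _ hce Y hY
  · exact hne x m hm hm0 _ hce Y hY

omit h₁ h₂ hind in
/-- Operators supported on orthogonal idempotents: a product `f * g` can only vanish if one of
the factors does. -/
lemma eq_zero_or_eq_zero_of_mul {f g : Module.End ℂ X}
    (hf : ∀ b, ∀ m ∈ M, ∀ Y ∈ homog E K W m, Commute f (ρ (b * (1 - e)) Y))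
    (hg : ∀ b, ∀ m ∈ M, ∀ Y ∈ homog E K W m, Commute g (ρ (b * e) Y)) (hfg : f * g = 0) :
    f = 0 ∨ g = 0 := by
  let S : Set (Module.End ℂ X) := {T | ∃ b, ∃ m ∈ M, ∃ Y ∈ homog E K W m, T = ρ (b * e) Y}
  have hS : ∀ T, (∀ s ∈ S, Commute T s) → ∀ s ∈ Algebra.adjoin ℂ S, Commute T s := by
    intro T hT s hs
    have hle : Algebra.adjoin ℂ S ≤ Subalgebra.centralizer ℂ {T} := by
      refine Algebra.adjoin_le fun s hs => Subalgebra.mem_centralizer_iff ℂ |>.mpr ?_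
      rintro _ rfl
      exact hT s hs
    exact Subalgebra.mem_centralizer_iff ℂ |>.mp (hle hs) T rfl
  let U : Submodule ℂ X :=
    { carrier := {x | ∀ s ∈ Algebra.adjoin ℂ S, f (s x) = 0}
      add_mem' := fun hx hy s hs => by rw [map_add, map_add, hx s hs, hy s hs, add_zero]
      zero_mem' := fun s _ => by rw [map_zero, map_zero]
      smul_mem' := fun c x hx s hs => by rw [map_smul, map_smul, hx s hs, smul_zero] }
  by_cases hg0 : g = 0
  · exact Or.inr hg0
  obtain ⟨x, hx⟩ : ∃ x, g x ≠ 0 := by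
    by_contra! h
    exact hg0 (LinearMap.ext h)
  have hU : U = ⊤ := by
    refine hρ.eq_top_of_isStable U (fun b m hm Y hY y hy s hs => ?_)
      ((Submodule.ne_bot_iff _).mpr ⟨g x, fun s hs => ?_, hx⟩)
    · have hb : ρ b Y y = ρ (b * e) Y y + ρ (b * (1 - e)) Y y := by
        rw [← LinearMap.add_apply, ← LinearMap.add_apply, ← map_add, ← mul_add, add_sub_cancel,
          mul_one]
      have hcomm : Commute (ρ (b * (1 - e)) Y) s := by
        refine hS _ ?_ s hs
        rintro _ ⟨c, k, hk, Z, hZ, rfl⟩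
        have : b * (1 - e) * (c * e) = -(b * c) * (e * e - e) := by ring
        rw [Commute, SemiconjBy, ← sub_eq_zero, hρ.comm hm hk hY hZ, this]
        exact he _ _ (M.add_mem hm hk) _ (hτ.lie_mem_homog hY hZ)
      rw [hb, map_add, map_add, ← Module.End.mul_apply s, ← Module.End.mul_apply s,
        hy _ (mul_mem hs (Algebra.subset_adjoin ⟨b, m, hm, Y, hY, rfl⟩)), zero_add, ← hcomm.eq,
        Module.End.mul_apply, ← Module.End.mul_apply, (hf b m hm Y hY).eq, Module.End.mul_apply,
        hy s hs, map_zero]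
    · have hcomm : Commute g s := by
        refine hS _ ?_ s hs
        rintro _ ⟨c, k, hk, Z, hZ, rfl⟩
        exact hg c k hk Z hZ
      rw [← Module.End.mul_apply s, ← hcomm.eq, Module.End.mul_apply, ← Module.End.mul_apply f,
        hfg, LinearMap.zero_apply]
  refine Or.inl (LinearMap.ext fun y => ?_)
  have hy : y ∈ U := by rw [hU]; trivial
  exact hy 1 (one_mem _)

/-- An idempotent modulo the annihilator is trivial. -/
lemma mem_annIdeal_or : e ∈ annIdeal E K W M ρ ∨ 1 - e ∈ annIdeal E K W M ρ := by
  obtain ⟨u, hu, -⟩ := hind.exists_dual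
  obtain ⟨w, hw, hwk⟩ := hind.symm.exists_dual
  have h0 : ∀ b, ∀ m ∈ M, ∀ Y ∈ homog E K W m, ρ (b * (e * (1 - e))) Y = 0 := by
    intro b m hm Y hY
    rw [show b * (e * (1 - e)) = -b * (e * e - e) by ring]
    exact he _ m hm Y hY
  have he' : (1 - e) * (1 - e) - (1 - e) ∈ annIdeal E K W M ρ := by
    convert he using 1; ring
  have hk₁ := M.neg_mem h₁
  have hP := W_mem_homog (E := E) (K := K) (W := W) k₁ u
  have hQ := W_mem_homog (E := E) (K := K) (W := W) (-k₁) u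
  have hD := W_mem_homog (E := E) (K := K) (W := W) 0 u
  set f := ρ e (lin W k₁ u) with hf
  set g := ρ (1 - e) (lin W (-k₁) u) with hg
  have hfc : ∀ b, ∀ m ∈ M, ∀ Y ∈ homog E K W m, Commute f (ρ (b * (1 - e)) Y) := by
    intro b m hm Y hY
    rw [Commute, SemiconjBy, ← sub_eq_zero, hf, hρ.comm h₁ hm hP hY,
      show e * (b * (1 - e)) = b * (e * (1 - e)) by ring]
    exact h0 _ _ (M.add_mem h₁ hm) _ (hτ.lie_mem_homog hP hY)
  have hgc : ∀ b, ∀ m ∈ M, ∀ Y ∈ homog E K W m, Commute g (ρ (b * e) Y) := by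
    intro b m hm Y hY
    rw [Commute, SemiconjBy, ← sub_eq_zero, hg, hρ.comm hk₁ hm hQ hY,
      show (1 - e) * (b * e) = b * (e * (1 - e)) by ring]
    exact h0 _ _ (M.add_mem hk₁ hm) _ (hτ.lie_mem_homog hQ hY)
  have hfg : Commute f g := by
    have := hfc 1 _ hk₁ _ hQ
    rwa [one_mul] at this
  have hfgN : f ^ N * g ^ N = 0 := by
    rw [← hfg.mul_pow]
    refine hρ.pow_eq_zero_of_eigenvector (h := ρ e (lin W 0 u)) (α := 1) (fun l x hx => ?_)
      (hρ.map_wt_zero hτ hD e) one_ne_zero ?_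
    · have := hρ.map_wt hτ h₁ hP e (hρ.map_wt hτ hk₁ hQ (1 - e) hx)
      rwa [toC_neg, neg_add_cancel_right] at this
    · have h1 : ρ e (lin W 0 u) * f - f * ρ e (lin W 0 u) = f := by
        rw [hf, hρ.comm M.zero_mem h₁ hD hP, hτ.lie_degree_s4 hP, hu, one_smul]
        simpa using apply_mul_eq_of_sub_mem he 1 h₁ hP
      have h2 : g * ρ e (lin W 0 u) = ρ e (lin W 0 u) * g := by
        simpa using (hgc 1 0 M.zero_mem _ hD).eq
      rw [mul_assoc f, h2, ← mul_assoc, ← mul_assoc, ← sub_mul, h1, one_smul]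
  rcases hρ.eq_zero_or_eq_zero_of_mul hτ he
    (fun b m hm Y hY => (hfc b m hm Y hY).pow_left N)
    (fun b m hm Y hY => (hgc b m hm Y hY).pow_left N) hfgN with h | h
  · exact Or.inl <| hρ.mem_annIdeal_of_isNilpotent hτ h₁ h₂ hind he h₁ h₂ hwk
      (by rw [hw]; exact one_ne_zero) (by rw [hu]; exact one_ne_zero) ⟨N, h⟩
  · exact Or.inr <| hρ.mem_annIdeal_of_isNilpotent hτ h₁ h₂ hind he' hk₁ h₂
      (by rw [toC_neg, dotProduct_neg, hwk, neg_zero]) (by rw [hw]; exact one_ne_zero)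
      (by rw [toC_neg, dotProduct_neg, hu]; exact neg_ne_zero.mpr one_ne_zero) ⟨N, h⟩

end Idempotent

/-- The representation factors through evaluation at a single point. -/
lemma exists_isMaximal [FiniteDimensional ℂ 𝔤] [Nontrivial X] [Nontrivial B]
    [IsNoetherianRing B] :
    ∃ 𝔐 : Ideal B, 𝔐.IsMaximal ∧ 𝔐 ≤ annIdeal E K W M ρ := by
  by_cases hJ : annIdeal E K W M ρ = ⊤
  · obtain ⟨𝔐, h𝔐⟩ := Ideal.exists_maximal B
    exact ⟨𝔐, h𝔐, hJ ▸ le_top⟩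
  obtain ⟨p, hp, a, haJ, hpa⟩ := exists_isPrime_colon hJ
  have hres := hρ.exists_sub_mem hτ h₁ h₂ hind hp
    fun b hb => (hpa b).mpr (Ideal.mul_mem_right _ _ hb)
  have hmul : ∀ {b : B} {c : ℂ}, b - algebraMap ℂ B c ∈ p → ∀ m ∈ M, ∀ Y ∈ homog E K W m,
      ρ (b * a) Y = c • ρ a Y := fun {b c} hbc m hm Y hY => by
    rw [hpa, sub_mul] at hbc
    have := apply_mul_eq_of_sub_mem hbc 1 hm hY
    rwa [one_mul, one_mul, ← Algebra.smul_def, map_smul] at this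
  have hap : a ∉ p := fun hap => haJ <| hρ.mem_annIdeal_of_sq hτ h₁ h₂ hind
    (fun b => (hres b).imp fun _ hc => hmul hc)
    fun m hm Y hY => by simpa using hmul (c := 0) (by simpa using hap) m hm Y hY
  obtain ⟨c, hc⟩ := hres a
  have hc0 : c ≠ 0 := by
    rintro rfl
    exact hap (by simpa using hc)
  have hcc : algebraMap ℂ B c⁻¹ * algebraMap ℂ B c = 1 := by
    rw [← map_mul, inv_mul_cancel₀ hc0, map_one]
  have he : algebraMap ℂ B c⁻¹ * a * (algebraMap ℂ B c⁻¹ * a) - algebraMap ℂ B c⁻¹ * a ∈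
      annIdeal E K W M ρ := by
    have := Ideal.mul_mem_left _ (algebraMap ℂ B c⁻¹ * algebraMap ℂ B c⁻¹) ((hpa _).mp hc)
    convert this using 1
    linear_combination (algebraMap ℂ B c⁻¹ * a) * hcc
  have he' : 1 - algebraMap ℂ B c⁻¹ * a ∈ annIdeal E K W M ρ := by
    refine (hρ.mem_annIdeal_or hτ h₁ h₂ hind he).resolve_left fun h => haJ ?_
    have := Ideal.mul_mem_left _ (algebraMap ℂ B c) h
    rwa [← mul_assoc, mul_comm (algebraMap ℂ B c), hcc, one_mul] at this
  refine ⟨p, Ideal.isMaximal_iff.mpr ⟨fun h => hp.ne_top ((Ideal.eq_top_iff_one _).mpr h),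
    fun I b hpI hbp hbI => ?_⟩, fun b hb => ?_⟩
  · obtain ⟨d, hd⟩ := hres b
    have hd0 : d ≠ 0 := by
      rintro rfl
      exact hbp (by simpa using hd)
    have hdI : algebraMap ℂ B d ∈ I := by simpa using I.sub_mem hbI (hpI hd)
    simpa [← map_mul, hd0] using I.mul_mem_left (algebraMap ℂ B d⁻¹) hdI
  · have h1 := Ideal.mul_mem_left _ b he'
    have h2 := Ideal.mul_mem_left _ (algebraMap ℂ B c⁻¹) ((hpa b).mp hb)
    convert Ideal.add_mem _ h1 h2 using 1
    ring

end IsCuspidalRep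

end Rep

section Module

variable {E : (Fin n → ℤ) → 𝔤 →ₗ[ℂ] τ} {K W : (Fin n → ℤ) → Fin n → τ}
variable {M : AddSubgroup (Fin n → ℤ)}

lemma homog_le_span {m : Fin n → ℤ} (hm : m ∈ M) :
    homog E K W m ≤ Submodule.span ℂ (tauMGens E K W M) := by
  refine homog_le (fun x => Submodule.subset_span ⟨m, hm, Or.inl (Or.inl ⟨x, rfl⟩)⟩)
    (fun s => ?_) (fun v => ?_)
  · rw [lin_apply]
    exact sum_mem fun i _ => Submodule.smul_mem _ _
      (Submodule.subset_span ⟨m, hm, Or.inl (Or.inr ⟨i, rfl⟩)⟩)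
  · rw [lin_apply]
    exact sum_mem fun i _ => Submodule.smul_mem _ _
      (Submodule.subset_span ⟨m, hm, Or.inr ⟨i, rfl⟩⟩)

lemma genOfDeg_subset_homog (m : Fin n → ℤ) : genOfDeg E K W m ⊆ homog E K W m := by
  rintro _ ((⟨x, rfl⟩ | ⟨i, rfl⟩) | ⟨i, rfl⟩)
  · exact E_mem_homog m x
  · exact lin_single K m i ▸ K_mem_homog m _
  · exact lin_single W m i ▸ W_mem_homog m _

variable {B : Type} [CommRing B] [Algebra ℂ B]

lemma tmul_mem_tauBM (a : B) {Y : τ} (hY : Y ∈ Submodule.span ℂ (tauMGens E K W M)) :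
    a ⊗ₜ[ℂ] Y ∈ tauBM B E K W M := by
  induction hY using Submodule.span_induction with
  | mem Y hY => exact LieSubalgebra.subset_lieSpan ⟨a, Y, hY, rfl⟩
  | zero => rw [TensorProduct.tmul_zero]; exact zero_mem _
  | add Y Z _ _ hY hZ => rw [TensorProduct.tmul_add]; exact add_mem hY hZ
  | smul c Y _ hY => rw [TensorProduct.tmul_smul]; exact (tauBM B E K W M).smul_mem c hY

variable {X : Type} [AddCommGroup X] [Module ℂ X]
  [LieRingModule ↥(tauBM B E K W M) X] [LieModule ℂ ↥(tauBM B E K W M) X]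

variable (E K W M B X) in
/-- The action of `τ(B)_M` on `X`, extended to a bilinear map on `B × τ`. -/
lemma exists_bilinear : ∃ ρ : B →ₗ[ℂ] τ →ₗ[ℂ] Module.End ℂ X,
    ∀ a, ∀ Y ∈ Submodule.span ℂ (tauMGens E K W M), ∀ h : a ⊗ₜ[ℂ] Y ∈ tauBM B E K W M,
      ∀ x, ρ a Y x = ⁅(⟨a ⊗ₜ[ℂ] Y, h⟩ : ↥(tauBM B E K W M)), x⁆ := by
  set T := Submodule.span ℂ (tauMGens E K W M)
  obtain ⟨π, hπ⟩ := T.subtype.exists_leftInverse_of_injective T.ker_subtype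
  let ι : B →ₗ[ℂ] T →ₗ[ℂ] ↥(tauBM B E K W M) :=
    LinearMap.mk₂ ℂ (fun a Y => ⟨a ⊗ₜ[ℂ] (Y : τ), tmul_mem_tauBM a Y.2⟩)
      (fun a b Y => Subtype.ext (TensorProduct.add_tmul a b (Y : τ)))
      (fun c a Y => Subtype.ext (TensorProduct.smul_tmul' c a (Y : τ)))
      (fun a Y Z => Subtype.ext (TensorProduct.tmul_add a (Y : τ) (Z : τ)))
      (fun c a Y => Subtype.ext (TensorProduct.tmul_smul c a (Y : τ)))
  refine ⟨(ι.compl₂ π).compr₂ (LieModule.toEnd ℂ (tauBM B E K W M) X : _ →ₗ[ℂ] _),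
    fun a Y hY h x => ?_⟩
  have : π Y = ⟨Y, hY⟩ := LinearMap.congr_fun hπ ⟨Y, hY⟩
  simp [this, ι]

variable {κ : 𝔤 →ₗ[ℂ] 𝔤 →ₗ[ℂ] ℂ} {c₁ c₂ : ℂ}

/-- The bilinear map of an irreducible cuspidal module over `τ(B)_M` is a cuspidal
representation. -/
lemma exists_isCuspidalRep (hτ : IsFullToroidal n 𝔤 τ κ c₁ c₂ E K W)
    (hirr : LieModule.IsIrreducible ℂ ↥(tauBM B E K W M) X)
    (hcusp : IsCuspidal (V := X) (dOpM B E K W M))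
    {ρ : B →ₗ[ℂ] τ →ₗ[ℂ] Module.End ℂ X}
    (hρ : ∀ a, ∀ Y ∈ Submodule.span ℂ (tauMGens E K W M),
      ∀ h : a ⊗ₜ[ℂ] Y ∈ tauBM B E K W M,
      ∀ x, ρ a Y x = ⁅(⟨a ⊗ₜ[ℂ] Y, h⟩ : ↥(tauBM B E K W M)), x⁆) :
    ∃ N, IsCuspidalRep E K W M ρ N := by
  have hd : ∀ i x, ρ 1 (W 0 i) x = ⁅dOpM B E K W M i, x⁆ := fun i x =>
    hρ 1 _ (Submodule.subset_span ⟨0, M.zero_mem, Or.inr ⟨i, rfl⟩⟩) _ x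
  have hwt : ∀ l, wt W ρ l = weightSpace (V := X) (dOpM B E K W M) l := by
    intro l
    ext x
    rw [mem_wt]
    change _ ↔ ∀ i, ⁅dOpM B E K W M i, x⁆ = l i • x
    refine ⟨fun h i => ?_, fun h v => ?_⟩
    · rw [← hd, ← lin_single W 0 i, h, single_one_dotProduct]
    · rw [lin_apply, map_sum, LinearMap.sum_apply, dotProduct, Finset.sum_smul]
      refine Finset.sum_congr rfl fun i _ => ?_
      rw [map_smul, LinearMap.smul_apply, hd, h, smul_smul]
  obtain ⟨⟨hsup, hfin⟩, N, hN⟩ := hcusp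
  refine ⟨N, fun {m k} hm hk {Y Z} hY hZ a b => ?_, fun U hU hU0 => ?_, ?_, fun l => ?_,
    fun l => ?_⟩
  · ext x
    have hY' := homog_le_span hm hY
    have hZ' := homog_le_span hk hZ
    have hYZ := homog_le_span (M.add_mem hm hk) (hτ.lie_mem_homog hY hZ)
    rw [LinearMap.sub_apply, Module.End.mul_apply, Module.End.mul_apply,
      hρ _ _ hY' (tmul_mem_tauBM _ hY'), hρ _ _ hY' (tmul_mem_tauBM _ hY'),
      hρ _ _ hZ' (tmul_mem_tauBM _ hZ'), hρ _ _ hZ' (tmul_mem_tauBM _ hZ'),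
      hρ _ _ hYZ (tmul_mem_tauBM _ hYZ), ← lie_lie]
    congr 1
  · have hz : ∀ z (h : z ∈ tauBM B E K W M), ∀ x ∈ U,
        ⁅(⟨z, h⟩ : ↥(tauBM B E K W M)), x⁆ ∈ U := by
      intro z h
      induction h using LieSubalgebra.lieSpan_induction with
      | mem z hz =>
        obtain ⟨a, Y, ⟨m, hm, hY⟩, rfl⟩ := hz
        intro x hx
        have hY' := genOfDeg_subset_homog m hY
        exact hρ a Y (homog_le_span hm hY') (tmul_mem_tauBM a (homog_le_span hm hY')) x ▸
          hU a m hm Y hY' x hx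
      | zero => exact fun x _ => (zero_lie (L := ↥(tauBM B E K W M)) x).symm ▸ U.zero_mem
      | smul c z hz ih =>
        intro x hx
        exact smul_lie c (⟨z, hz⟩ : ↥(tauBM B E K W M)) x ▸ U.smul_mem c (ih x hx)
      | add y z hy hz ihy ihz =>
        intro x hx
        exact add_lie (⟨y, hy⟩ : ↥(tauBM B E K W M)) ⟨z, hz⟩ x ▸ U.add_mem (ihy x hx) (ihz x hx)
      | lie y z hy hz ihy ihz =>
        intro x hx
        exact lie_lie (⟨y, hy⟩ : ↥(tauBM B E K W M)) ⟨z, hz⟩ x ▸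
          U.sub_mem (ihy _ (ihz x hx)) (ihz _ (ihy x hx))
    let U' : LieSubmodule ℂ ↥(tauBM B E K W M) X :=
      { U with lie_mem := fun {z x} hx => hz z.1 z.2 x hx }
    have : IsSimpleOrder (LieSubmodule ℂ ↥(tauBM B E K W M) X) := hirr
    rcases eq_bot_or_eq_top U' with h | h
    · exact absurd (congrArg LieSubmodule.toSubmodule h) hU0
    · exact congrArg LieSubmodule.toSubmodule h
  · simp_rw [hwt, hsup]
  · rw [hwt]; exact hfin l
  · rw [hwt]; exact hN l

end Module

theorem statement_4
    (n : ℕ) (hn : 3 ≤ n)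
    (𝔤 : Type) [LieRing 𝔤] [LieAlgebra ℂ 𝔤] [LieAlgebra.IsSimple ℂ 𝔤]
    [FiniteDimensional ℂ 𝔤]
    (τ : Type) [LieRing τ] [LieAlgebra ℂ τ]
    (κ : 𝔤 →ₗ[ℂ] 𝔤 →ₗ[ℂ] ℂ) (c₁ c₂ : ℂ)
    (E : (Fin n → ℤ) → 𝔤 →ₗ[ℂ] τ) (K W : (Fin n → ℤ) → Fin n → τ)
    (hτ : IsFullToroidal n 𝔤 τ κ c₁ c₂ E K W)
    (B : Type) [CommRing B] [Algebra ℂ B] [Nontrivial B]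
    (hB : Algebra.FiniteType ℂ B)
    (M : AddSubgroup (Fin n → ℤ)) (β : Fin n → ℤ)
    (hcompl : IsCompl M (AddSubgroup.zmultiples β))
    (X : Type) [AddCommGroup X] [Module ℂ X]
    [LieRingModule ↥(tauBM B E K W M) X] [LieModule ℂ ↥(tauBM B E K W M) X]
    (hirr : LieModule.IsIrreducible ℂ ↥(tauBM B E K W M) X)
    (hcusp : IsCuspidal (V := X) (dOpM B E K W M)) :
    ∃ 𝔐 : Ideal B, 𝔐.IsMaximal ∧
      ∀ a ∈ 𝔐, ∀ Y ∈ tauMGens E K W M,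
        ∀ (hz : a ⊗ₜ[ℂ] Y ∈ tauBM B E K W M) (u : X),
          ⁅(⟨a ⊗ₜ[ℂ] Y, hz⟩ : ↥(tauBM B E K W M)), u⁆ = 0 := by
  have : IsSimpleOrder (LieSubmodule ℂ ↥(tauBM B E K W M) X) := hirr
  have : Nontrivial X := (LieSubmodule.nontrivial_iff ℂ ↥(tauBM B E K W M) X).mp inferInstance
  have : IsNoetherianRing B := Algebra.FiniteType.isNoetherianRing ℂ B
  obtain ⟨k₁, h₁, k₂, h₂, hind⟩ := exists_indep hn hcompl
  obtain ⟨ρ, hρ⟩ := exists_bilinear E K W M B X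
  obtain ⟨N, hN⟩ := exists_isCuspidalRep hτ hirr hcusp hρ
  obtain ⟨𝔐, hmax, hle⟩ := hN.exists_isMaximal hτ h₁ h₂ hind
  refine ⟨𝔐, hmax, fun a ha Y ⟨m, hm, hY⟩ hz u => ?_⟩
  have hY' := genOfDeg_subset_homog m hY
  have h0 := hle ha 1 m hm Y hY'
  rw [one_mul] at h0
  rw [← hρ a Y (homog_le_span hm hY'), h0, LinearMap.zero_apply]

end MT
end
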